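/- Let w be a permutation with ℓ(w) ≥ 1 and let B ∈ BPD(w). Writing pop(B) = (r, a), the output ∇B of the Gao–Huang procedure is a bumpless pipe dream with permutation s_a w, and ℓ(s_a w) = ℓ(w) − 1; in particular ∇ maps BPD(w) into BPD(v) for a permutation v of length ℓ(w) − 1. -/

import Mathlib

/- Common definitions for formalizing "Lenart's bijection via bumpless pipe dreams"
   (Gregory–Hamaker). -/

namespace BPDPaper

/-! ### Permutations of the positive integers -/

/-- We model permutations of the positive integers as permutations of `ℕ`
(fixing `0`, with finite support). -/
abbrev Perm' := Equiv.Perm ℕ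

/-- The simple transposition `s_a = t_{a,a+1}`. -/
def sT (a : ℕ) : Perm' := Equiv.swap a (a + 1)

/-- The transposition `t_{ij}`. -/
def tT (i j : ℕ) : Perm' := Equiv.swap i j

/-- The product `s_{a_1} ⋯ s_{a_p}` of a word. -/
def wordProd (l : List ℕ) : Perm' := (l.map sT).prod

/-- `l` is a word for `w` (in the letters `s_1, s_2, …`). -/
def IsWord (w : Perm') (l : List ℕ) : Prop := (∀ x ∈ l, 1 ≤ x) ∧ wordProd l = w

/-- The Coxeter length `ℓ(w)`: the minimal length of a word for `w`. -/
noncomputable def plen (w : Perm') : ℕ :=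
  sInf {m | ∃ l : List ℕ, IsWord w l ∧ l.length = m}

/-- `l` is a reduced word for `w`. -/
def IsReducedWord (w : Perm') (l : List ℕ) : Prop := IsWord w l ∧ l.length = plen w

/-- A permutation of the positive integers: fixes `0` and all but finitely many points. -/
def IsPerm (w : Perm') : Prop := w 0 = 0 ∧ {k | w k ≠ k}.Finite

/-- `k` is a descent of `w`. -/
def Descent (w : Perm') (k : ℕ) : Prop := 1 ≤ k ∧ w (k + 1) < w k

/-- `w` is Grassmannian: at most one descent. -/
def Grassmannian (w : Perm') : Prop := IsPerm w ∧ Set.Subsingleton {k | Descent w k}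

/-- `w` is vexillary: no indices `i < j < k < l` with `w j < w i < w l < w k`
(pattern 2143 avoidance). -/
def Vexillary (w : Perm') : Prop := IsPerm w ∧
  ¬ ∃ i j k l : ℕ, 1 ≤ i ∧ i < j ∧ j < k ∧ k < l ∧ w j < w i ∧ w i < w l ∧ w l < w k

/-- The code `c_i(w) = #{j > i : w j < w i}`. -/
noncomputable def codeOf (w : Perm') (i : ℕ) : ℕ := Nat.card {j : ℕ | i < j ∧ w j < w i}

/-- Insert into a weakly decreasing list, keeping it weakly decreasing. -/
def insDesc (x : ℕ) : List ℕ → List ℕ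
  | [] => [x]
  | y :: ys => if y < x then x :: y :: ys else y :: insDesc x ys

/-- Sort a list into weakly decreasing order. -/
def sortDesc (l : List ℕ) : List ℕ := l.foldr insDesc []

/-- The shape `λ(w)`: the code `(c_1(w), …, c_n(w))` sorted decreasingly, zeros dropped
(`n` is any bound on the support of `w`). -/
noncomputable def shapeOf (w : Perm') (n : ℕ) : List ℕ :=
  (sortDesc ((List.range' 1 n).map (codeOf w))).filter (fun x => decide (0 < x))

/-- The Rothe diagram `D_w = {(i, w j) : i < j, w j < w i}` (matrix coordinates). -/
def RotheDiagram (w : Perm') : Set (ℕ × ℕ) :=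
  {p | 1 ≤ p.1 ∧ ∃ j, p.1 < j ∧ w j < w p.1 ∧ p.2 = w j}

/-- `φ_i`: the row index of the southeast-most box of `D_w` on the diagonal through
`(i, λ_i)`. -/
noncomputable def flagEntry (w : Perm') (i li : ℕ) : ℕ :=
  sSup {r : ℕ | ∃ c : ℕ, (r, c) ∈ RotheDiagram w ∧ (c : ℤ) - (r : ℤ) = (li : ℤ) - (i : ℤ)}

/-- The flag `φ(w) = (φ_1, …, φ_m)` of a vexillary permutation. -/
noncomputable def flagOf (w : Perm') (n : ℕ) : List ℕ :=
  (List.range (shapeOf w n).length).map (fun k => flagEntry w (k + 1) ((shapeOf w n).getD k 0))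

/-- `ρ(w)_i`: the `i`-th row of the smallest partition whose Young diagram contains `D_w`. -/
noncomputable def rhoRow (w : Perm') (i : ℕ) : ℕ :=
  sSup {c : ℕ | ∃ r : ℕ, i ≤ r ∧ (r, c) ∈ RotheDiagram w}

/-! ### Tableaux (lists of rows), flagged SSYT, jeu de taquin -/

/-- Semistandard Young tableau of partition shape, presented as a list of rows. -/
def IsSSYT (T : List (List ℕ)) : Prop :=
  (∀ row ∈ T, row ≠ []) ∧
  List.Chain' (fun r1 r2 : List ℕ => r2.length ≤ r1.length) T ∧
  (∀ row ∈ T, List.Chain' (· ≤ ·) row) ∧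
  (∀ i j : ℕ, i + 1 < T.length → j < (T.getD (i + 1) []).length →
    (T.getD i []).getD j 0 < (T.getD (i + 1) []).getD j 0)

/-- `φ`-flagged semistandard Young tableaux of shape `λ`: the last entry of row `i`
is at most `φ_i`. -/
def IsFlaggedSSYT (lam phi : List ℕ) (T : List (List ℕ)) : Prop :=
  IsSSYT T ∧ T.map List.length = lam ∧
  ∀ i : ℕ, i < T.length → (T.getD i []).getLastD 0 ≤ phi.getD i 0

/-- Semistandard Young tableaux with all entries at most `k` (`SSYT_k`). -/
def IsSSYTBounded (k : ℕ) (T : List (List ℕ)) : Prop :=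
  IsSSYT T ∧ ∀ row ∈ T, ∀ x ∈ row, x ≤ k

/-- Set an entry of a tableau. -/
def setEntry (T : List (List ℕ)) (r c x : ℕ) : List (List ℕ) :=
  T.set r ((T.getD r []).set c x)

/-- One jeu de taquin slide with the empty tile at `(r, c)` (0-indexed):
swap the empty tile with the smaller of the entries to its right and below
(ties move down; missing boxes are `∞`); when both are missing, delete the cell. -/
def jdtAux : ℕ → List (List ℕ) → ℕ → ℕ → List (List ℕ)
  | 0, T, _, _ => T
  | fuel + 1, T, r, c =>
    match (T.getD r [])[c + 1]?, (T.getD (r + 1) [])[c]? with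
    | none, none => (T.set r ((T.getD r []).take c)).filter (fun row => !row.isEmpty)
    | some x, none => jdtAux fuel (setEntry T r c x) r (c + 1)
    | none, some y => jdtAux fuel (setEntry T r c y) (r + 1) c
    | some x, some y =>
      if x < y then jdtAux fuel (setEntry T r c x) r (c + 1)
      else jdtAux fuel (setEntry T r c y) (r + 1) c

/-- `jdt(T)`: remove the top-left box of `T` and rectify by jeu de taquin. -/
def jdt (T : List (List ℕ)) : List (List ℕ) :=
  jdtAux ((T.map List.length).sum + 1) T 0 0

/-! ### Edelman–Greene column insertion and the recording tableau -/

/-- Edelman–Greene insertion of `x` into one increasing column `C`.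
Returns the new column together with `none` (if `x` was appended, creating a new box)
or `some y` (where `y` is to be inserted into the next column). -/
def colIns (x : ℕ) (C : List ℕ) : List ℕ × Option ℕ :=
  if C.all (fun c => decide (c < x)) then (C ++ [x], none)
  else if x ∈ C ∧ (x + 1) ∈ C then (C, some (x + 1))
  else
    match C.find? (fun c => decide (x < c)) with
    | some ck => (C.map (fun c => if c = ck then x else c), some ck)
    | none => (C, none)

/-- Edelman–Greene insertion of `x` into a tableau presented as a list of columns.
Returns the new columns and the (0-indexed) column containing the new box. -/
def egInsert : List (List ℕ) → ℕ → (List (List ℕ)) × ℕ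
  | [], x => ([[x]], 0)
  | C :: rest, x =>
    match colIns x C with
    | (C', none) => (C' :: rest, 0)
    | (C', some y) =>
      let res := egInsert rest y
      (C' :: res.1, res.2 + 1)

/-- One step of the Edelman–Greene algorithm on the pair (insertion, recording) tableau:
insert `ra.2` into `P` and record `ra.1` in the new box of `Q`. -/
def egStep (PQ : (List (List ℕ)) × (List (List ℕ))) (ra : ℕ × ℕ) :
    (List (List ℕ)) × (List (List ℕ)) :=
  let res := egInsert PQ.1 ra.2
  let Q := PQ.2
  let Q' := if res.2 < Q.length then Q.set res.2 (Q.getD res.2 [] ++ [ra.1]) else Q ++ [[ra.1]]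
  (res.1, Q')

/-- A biword `(r_1,…,r_l ; a_1,…,a_l)`. -/
structure Biword where
  top : List ℕ
  bot : List ℕ

/-- The (insertion, recording) column tableaux of a biword under Edelman–Greene insertion. -/
def egPQ (P : Biword) : (List (List ℕ)) × (List (List ℕ)) :=
  (P.top.zip P.bot).foldl egStep ([], [])

/-- Convert a tableau presented as a list of columns into a list of rows. -/
def colsToRows (cols : List (List ℕ)) : List (List ℕ) :=
  (List.range ((cols.map List.length).foldr max 0)).map
    (fun i => cols.filterMap (fun col => col[i]?))

/-- The Edelman–Greene recording tableau `Q̃` of a biword (as a list of rows). -/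
def Qtilde (P : Biword) : List (List ℕ) := colsToRows (egPQ P).2

/-- The Edelman–Greene insertion tableau `P̃` of a biword (as a list of rows). -/
def Ptilde (P : Biword) : List (List ℕ) := colsToRows (egPQ P).1

/-- `(r ; a)` is a reduced compatible sequence for `w`: `a` is a reduced word for `w`,
`r` is weakly increasing, `r_i ≤ a_i`, and `r_i < r_{i+1}` whenever `a_i < a_{i+1}`.
Membership in `PD(w)`. -/
def IsCompatible (w : Perm') (P : Biword) : Prop :=
  IsReducedWord w P.bot ∧
  List.Chain' (· ≤ ·) P.top ∧
  List.Forall₂ (· ≤ ·) P.top P.bot ∧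
  (∀ m : ℕ, m + 1 < P.bot.length →
    P.bot.getD m 0 < P.bot.getD (m + 1) 0 → P.top.getD m 0 < P.top.getD (m + 1) 0)

/-! ### Bumpless pipe dreams -/

/-- The tiles: blank, vertical, horizontal, ⌐-elbow (S–E, "r"), ⌟-elbow (W–N, "j"),
crossing, and the bump tile (for almost bumpless pipe dreams). -/
inductive Tile
  | blank | vert | horiz | se | nw | cross | bump
deriving DecidableEq

/-- A square grid of tiles; rows and columns are 1-indexed, rows increase downward. -/
structure Grid where
  n : ℕ
  tile : ℕ → ℕ → Tile

inductive Dir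
  | north | east
deriving DecidableEq

def hasN : Tile → Bool
  | .vert => true | .nw => true | .cross => true | .bump => true | _ => false
def hasS : Tile → Bool
  | .vert => true | .se => true | .cross => true | .bump => true | _ => false
def hasE : Tile → Bool
  | .horiz => true | .se => true | .cross => true | .bump => true | _ => false
def hasW : Tile → Bool
  | .horiz => true | .nw => true | .cross => true | .bump => true | _ => false

/-- The outgoing direction of a pipe through a tile, given the incoming heading
(`north` = entered through the south edge, `east` = entered through the west edge). -/
def outDir : Tile → Dir → Option Dir
  | .vert, .north => some .north
  | .cross, .north => some .north
  | .se, .north => some .east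
  | .bump, .north => some .east
  | .horiz, .east => some .east
  | .cross, .east => some .east
  | .nw, .east => some .north
  | .bump, .east => some .north
  | _, _ => none

/-- Trace a pipe; returns the row in which it exits through the east edge of the grid. -/
def traceAux (g : Grid) : ℕ → ℕ → ℕ → Dir → Option ℕ
  | 0, _, _, _ => none
  | fuel + 1, x, y, d =>
    match outDir (g.tile x y) d with
    | none => none
    | some Dir.north => if x ≤ 1 then none else traceAux g fuel (x - 1) y Dir.north
    | some Dir.east => if g.n ≤ y then some x else traceAux g fuel x (y + 1) Dir.east

/-- The exit row of the pipe entering at the bottom of column `c`. -/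
def exitRow (g : Grid) (c : ℕ) : Option ℕ := traceAux g (2 * g.n + 2) g.n c Dir.north

/-- The list of states `(row, column, heading)` visited by a pipe. -/
def pathAux (g : Grid) : ℕ → ℕ → ℕ → Dir → List (ℕ × ℕ × Dir)
  | 0, _, _, _ => []
  | fuel + 1, x, y, d =>
    (x, y, d) ::
      (match outDir (g.tile x y) d with
       | none => []
       | some Dir.north => if x ≤ 1 then [] else pathAux g fuel (x - 1) y Dir.north
       | some Dir.east => if g.n ≤ y then [] else pathAux g fuel x (y + 1) Dir.east)

/-- The path of the pipe entering at the bottom of column `c`. -/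
def pipePath (g : Grid) (c : ℕ) : List (ℕ × ℕ × Dir) := pathAux g (2 * g.n + 2) g.n c Dir.north

/-- Pipe `c` passes through position `z`. -/
def passes (g : Grid) (c : ℕ) (z : ℕ × ℕ) : Prop :=
  ∃ d : Dir, (z.1, z.2, d) ∈ pipePath g c

def InGrid (g : Grid) (i j : ℕ) : Prop := 1 ≤ i ∧ i ≤ g.n ∧ 1 ≤ j ∧ j ≤ g.n

/-- A (reduced) bumpless pipe dream: tiles match along edges; pipes enter along the
bottom and exit along the right; no bump tiles; no two pipes cross more than once.
(Tiles outside the grid are normalized to `horiz`.) -/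
def IsBPD (g : Grid) : Prop :=
  1 ≤ g.n ∧
  (∀ i j, ¬ InGrid g i j → g.tile i j = Tile.horiz) ∧
  (∀ i j, InGrid g i j → g.tile i j ≠ Tile.bump) ∧
  (∀ i j, 1 ≤ i → i < g.n → 1 ≤ j → j ≤ g.n → hasS (g.tile i j) = hasN (g.tile (i + 1) j)) ∧
  (∀ i j, 1 ≤ i → i ≤ g.n → 1 ≤ j → j < g.n → hasE (g.tile i j) = hasW (g.tile i (j + 1))) ∧
  (∀ j, 1 ≤ j → j ≤ g.n → hasN (g.tile 1 j) = false) ∧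
  (∀ j, 1 ≤ j → j ≤ g.n → hasS (g.tile g.n j) = true) ∧
  (∀ i, 1 ≤ i → i ≤ g.n → hasW (g.tile i 1) = false) ∧
  (∀ i, 1 ≤ i → i ≤ g.n → hasE (g.tile i g.n) = true) ∧
  (∀ c c', 1 ≤ c → c ≤ g.n → 1 ≤ c' → c' ≤ g.n → c ≠ c' →
    Set.Subsingleton {z : ℕ × ℕ | g.tile z.1 z.2 = Tile.cross ∧ passes g c z ∧ passes g c' z})

/-- `g ∈ BPD(w)`: `g` is a bumpless pipe dream whose permutation is `w`, i.e. the pipe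
entering at the bottom of column `c` exits to the right in row `w⁻¹(c)`. -/
def MemBPD (w : Perm') (g : Grid) : Prop :=
  IsBPD g ∧ w 0 = 0 ∧ (∀ k, g.n < k → w k = k) ∧
  (∀ c, 1 ≤ c → c ≤ g.n → exitRow g c = some (w.symm c))

/-! ### Weigandt's map γ -/

/-- The blank tiles on the diagonal `{(i,j) : j - i = d}`, from northwest to southeast. -/
def blanksOnDiag (g : Grid) (d : ℤ) : List (ℕ × ℕ) :=
  (List.range' 1 g.n).filterMap (fun (i : ℕ) =>
    let jz : ℤ := (i : ℤ) + d
    if 1 ≤ jz ∧ jz ≤ (g.n : ℤ) then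
      (if g.tile i jz.toNat = Tile.blank then some (i, jz.toNat) else none)
    else none)

/-- The number of pipes passing above position `(i,j)`: tiles above it in column `j`
in which a pipe travels eastward. -/
def pipesAbove (g : Grid) (i j : ℕ) : ℕ :=
  ((List.range' 1 g.n).filter (fun x => decide (x < i) && hasE (g.tile x j))).length

/-- Weigandt's map `γ` (for vexillary permutations): fill each blank tile with the number
of pipes above it, slide the filled tiles northwest along their diagonals into the Young
diagram of `lam`, and add `i` to every entry in row `i`. -/
def weigandt (g : Grid) (lam : List ℕ) : List (List ℕ) :=
  (List.range lam.length).map (fun (r0 : ℕ) =>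
    (List.range (lam.getD r0 0)).map (fun (c0 : ℕ) =>
      let r : ℕ := r0 + 1
      let c : ℕ := c0 + 1
      let p := (blanksOnDiag g ((c : ℤ) - (r : ℤ))).getD (min r c - 1) (0, 0)
      pipesAbove g p.1 p.2 + r))

/-! ### The Gao–Huang operator ∇, pop, and the bijection φ -/

/-- Backward tracing: enter tile `(x,y)` through its north edge (`viaN = true`) or its
east edge (`viaN = false`) and follow the pipe backwards; returns the bottom column
at which the pipe enters the grid. -/
def backAux (g : Grid) : ℕ → ℕ → ℕ → Bool → Option ℕ
  | 0, _, _, _ => none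
  | fuel + 1, x, y, viaN =>
    if g.n < x then none
    else if viaN then
      match g.tile x y with
      | .vert | .cross => if x = g.n then some y else backAux g fuel (x + 1) y true
      | .nw | .bump => backAux g fuel x (y - 1) false
      | _ => none
    else
      match g.tile x y with
      | .horiz | .cross => backAux g fuel x (y - 1) false
      | .se | .bump => if x = g.n then some y else backAux g fuel (x + 1) y true
      | _ => none

/-- The label of the pipe passing through `(x,y)` entering from the south. -/
def pipeFromS (g : Grid) (x y : ℕ) : Option ℕ :=
  if x = g.n then some y else backAux g (2 * g.n + 2) (x + 1) y true

/-- Move the mark east to the rightmost blank tile in its contiguous block of blanks. -/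
def slideEast (g : Grid) (i j : ℕ) : ℕ :=
  ((List.range' j (g.n + 1)).takeWhile (fun y => g.tile i y == Tile.blank)).getLastD j

/-- Tile rewrite for the undroop of the pipe `p` (from `(i', j+1)` into `(i, j)`)
performed in one iteration of the Gao–Huang procedure; the `(i', j+1)` case `cross → se`
is the final uncrossing step. -/
def nablaUndroop (T : ℕ → ℕ → Tile) (i i' j : ℕ) : ℕ → ℕ → Tile := fun x y =>
  let t := T x y
  if x = i ∧ y = j then (match t with | Tile.blank => Tile.se | _ => t)
  else if x = i' ∧ y = j then
    (match t with | Tile.se => Tile.vert | Tile.horiz => Tile.nw | _ => t)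
  else if x = i ∧ y = j + 1 then
    (match t with | Tile.se => Tile.horiz | Tile.vert => Tile.nw | _ => t)
  else if x = i' ∧ y = j + 1 then
    (match t with | Tile.nw => Tile.blank | Tile.cross => Tile.se | _ => t)
  else if y = j ∧ i < x ∧ x < i' then
    (match t with | Tile.blank => Tile.vert | Tile.horiz => Tile.cross | _ => t)
  else if y = j + 1 ∧ i < x ∧ x < i' then
    (match t with | Tile.vert => Tile.blank | Tile.cross => Tile.horiz | _ => t)
  else t

/-- Tile rewrite for the droop (from `(k, j)` into `(k', j+1)`) of a pipe `q` having both
a ⌐-turn and a ⌟-turn in column `j`, performed after the undroop of `p`. -/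
def nablaQDroop (T : ℕ → ℕ → Tile) (k k' j : ℕ) : ℕ → ℕ → Tile := fun x y =>
  let t := T x y
  if x = k ∧ y = j then (match t with | Tile.se => Tile.vert | _ => t)
  else if x = k' ∧ y = j then (match t with | Tile.nw => Tile.cross | _ => t)
  else if x = k ∧ y = j + 1 then (match t with | Tile.horiz => Tile.se | _ => t)
  else if x = k' ∧ y = j + 1 then (match t with | Tile.blank => Tile.nw | _ => t)
  else if y = j + 1 ∧ k < x ∧ x < k' then
    (match t with | Tile.blank => Tile.vert | Tile.horiz => Tile.cross | _ => t)
  else t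

/-- The ⌐/⌟ elbow pairs `(k, k')` of pipes in column `j` strictly between rows `i` and `i'`. -/
def qPairs (g : Grid) (i i' j : ℕ) : List (ℕ × ℕ) :=
  (List.range' 1 g.n).filterMap (fun k =>
    if i < k ∧ k < i' ∧ g.tile k j = Tile.se then
      match (List.range' 1 g.n).find?
          (fun k' => decide (k < k' ∧ k' < i' ∧ g.tile k' j = Tile.nw)) with
      | some k' => some (k, k')
      | none => none
    else none)

/-- One iteration of the marked-tile procedure on the rectangle with corners
`(i, j)` and `(i', j+1)`: undroop `p`, then droop the intersecting pipes. -/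
def nablaIter (g : Grid) (i i' j : ℕ) : Grid :=
  ⟨g.n, (qPairs g i i' j).foldl (fun T kk => nablaQDroop T kk.1 kk.2 j)
    (nablaUndroop g.tile i i' j)⟩

/-- The marked-tile loop of the Gao–Huang procedure; returns `(∇B, a)`. -/
def nablaLoop (g : Grid) : ℕ → ℕ × ℕ → Grid × ℕ
  | 0, _ => (g, 0)
  | fuel + 1, (i, j0) =>
    let j := slideEast g i j0
    match pipeFromS g i (j + 1) with
    | none => (g, 0)
    | some p =>
      if p = j + 1 then
        match (List.range' 1 g.n).find? (fun x =>
            decide (i < x) && (g.tile x (j + 1) == Tile.cross) &&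
            (backAux g (2 * g.n + 2) x (j + 1) false == some j)) with
        | some i' => (nablaIter g i i' j, j)
        | none => (g, 0)
      else
        match (List.range' 1 g.n).find? (fun x =>
            decide (i < x) && (g.tile x (j + 1) == Tile.nw)) with
        | some i' => nablaLoop (nablaIter g i i' j) fuel (i', j + 1)
        | none => (g, 0)

/-- The Gao–Huang procedure: returns `(∇B, (r, a))` where `pop(B) = (r, a)`. -/
def nablaPop (g : Grid) : Grid × ℕ × ℕ :=
  match (List.range' 1 g.n).find?
      (fun i => (List.range' 1 g.n).any (fun j => g.tile i j == Tile.blank)) with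
  | none => (g, 0, 0)
  | some r =>
    let j0 := ((List.range' 1 g.n).filter (fun j => g.tile r j == Tile.blank)).getLastD 0
    let res := nablaLoop g (g.n + 1) (r, j0)
    (res.1, r, res.2)

/-- The Gao–Huang operator `∇`. -/
def nabla (g : Grid) : Grid := (nablaPop g).1

/-- `pop(B) = (r, a)`. -/
def pop (g : Grid) : ℕ × ℕ := (nablaPop g).2

/-- The number of crossing tiles of `g` (which equals `ℓ(w)` for `g ∈ BPD(w)`). -/
def crossCount (g : Grid) : ℕ :=
  ((List.range' 1 g.n).map (fun i =>
    ((List.range' 1 g.n).filter (fun j => g.tile i j == Tile.cross)).length)).sum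

def phiAux : ℕ → Grid → List (ℕ × ℕ)
  | 0, _ => []
  | l + 1, g => pop g :: phiAux l (nabla g)

/-- The Gao–Huang bijection `φ : BPD(w) → PD(w)`,
`φ(B) = (r_1,…,r_l ; a_1,…,a_l)` with `(r_i, a_i) = pop(∇^{i-1} B)`. -/
def phi (g : Grid) : Biword :=
  ⟨(phiAux (crossCount g) g).map Prod.fst, (phiAux (crossCount g) g).map Prod.snd⟩

/-! ### Little bumps (relational) -/

/-- The reflection labelling the crossing at position `m` (0-indexed) of the word `a`:
deleting the letter at position `m` from `a` yields a word for `wordProd a * crossingRefl a m`.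
The wires `i` and `j` cross at position `m` iff `crossingRefl a m = t_{ij}`. -/
def crossingRefl (a : List ℕ) (m : ℕ) : Perm' :=
  (wordProd (a.drop (m + 1)))⁻¹ * sT (a.getD m 0) * wordProd (a.drop (m + 1))

/-- `a` is a reduced word (for its own product). -/
def IsReducedSelf (a : List ℕ) : Prop := IsReducedWord (wordProd a) a

/-- Increment the entry of `a` at position `m`. -/
def incrAt (a : List ℕ) (m : ℕ) : List ℕ := a.set m (a.getD m 0 + 1)

/-- The (upward) Little bump `L_{ij}` as a relation on biwords: starting at the position
`m_1` where wires `i` and `j` cross, repeatedly increment the current entry; stop when the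
bottom word becomes reduced, and otherwise move to the unique other position whose crossing
involves the same pair of wires. -/
def LittleBumpRel (i j : ℕ) (P P' : Biword) : Prop :=
  P'.top = P.top ∧
  ∃ ms : List ℕ, ∃ ws : List (List ℕ),
    ms ≠ [] ∧
    ws.length = ms.length + 1 ∧
    ws.getD 0 [] = P.bot ∧
    ws.getLastD [] = P'.bot ∧
    (∀ t : ℕ, t < ms.length → ws.getD (t + 1) [] = incrAt (ws.getD t []) (ms.getD t 0)) ∧
    crossingRefl P.bot (ms.getD 0 0) = tT i j ∧
    (∀ t : ℕ, t + 1 < ms.length →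
      ¬ IsReducedSelf (ws.getD (t + 1) []) ∧
      ms.getD (t + 1) 0 ≠ ms.getD t 0 ∧
      crossingRefl (ws.getD (t + 1) []) (ms.getD t 0)
        = crossingRefl (ws.getD (t + 1) []) (ms.getD (t + 1) 0)) ∧
    IsReducedSelf P'.bot

/-! ### Huang bumps -/

/-- Least offset `t ≥ 1` satisfying `p` (searched up to `bound + 1`). -/
def leastOff (p : ℕ → Bool) (bound : ℕ) : ℕ :=
  ((List.range' 1 (bound + 1)).filter p).headD 1

/-- The southeast corner `(x + k, y + l)` of the min-droop at `(x, y)`: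
`k, l ≥ 1` minimal with `(x+k, y)` and `(x, y+l)` not crossing tiles. -/
def minDroopCorner (g : Grid) (x y : ℕ) : ℕ × ℕ :=
  (x + leastOff (fun k => !(g.tile (x + k) y == Tile.cross)) g.n,
   y + leastOff (fun l => !(g.tile x (y + l) == Tile.cross)) g.n)

/-- The min-droop at `(x, y)`: droop the ⌐-turn at `(x, y)` into `(x+k, y+l)`. -/
def minDroopT (g : Grid) (x y : ℕ) : Grid :=
  let k := leastOff (fun k => !(g.tile (x + k) y == Tile.cross)) g.n
  let l := leastOff (fun l => !(g.tile x (y + l) == Tile.cross)) g.n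
  ⟨g.n, fun a b =>
    let t := g.tile a b
    if a = x ∧ b = y then
      (match t with | Tile.se => Tile.blank | Tile.bump => Tile.nw | _ => t)
    else if a = x + k ∧ b = y then (match t with | Tile.vert => Tile.se | _ => t)
    else if a = x ∧ b = y + l then
      (match t with | Tile.horiz => Tile.se | Tile.nw => Tile.vert | _ => t)
    else if a = x + k ∧ b = y + l then
      (match t with | Tile.blank => Tile.nw | Tile.se => Tile.bump | _ => t)
    else if b = y ∧ x < a ∧ a < x + k then
      (match t with | Tile.cross => Tile.horiz | Tile.vert => Tile.blank | _ => t)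
    else if a = x ∧ y < b ∧ b < y + l then
      (match t with | Tile.cross => Tile.vert | Tile.horiz => Tile.blank | _ => t)
    else if a = x + k ∧ y < b ∧ b < y + l then
      (match t with | Tile.blank => Tile.horiz | Tile.vert => Tile.cross | _ => t)
    else if b = y + l ∧ x < a ∧ a < x + k then
      (match t with | Tile.blank => Tile.vert | Tile.horiz => Tile.cross | _ => t)
    else t⟩

/-- Replace a single tile. -/
def setTile (g : Grid) (x y : ℕ) (t : Tile) : Grid :=
  ⟨g.n, fun a b => if a = x ∧ b = y then t else g.tile a b⟩

/-- Pipe `c` passes through `(x, y)` (Boolean). -/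
def onPath (g : Grid) (c : ℕ) (x y : ℕ) : Bool :=
  decide ((x, y, Dir.north) ∈ pipePath g c) || decide ((x, y, Dir.east) ∈ pipePath g c)

/-- The position of the crossing tile where pipes `c` and `c'` cross, if any. -/
def findCrossing (g : Grid) (c c' : ℕ) : Option (ℕ × ℕ) :=
  (pipePath g c).findSome? (fun s =>
    if (g.tile s.1 s.2.1 == Tile.cross) && onPath g c' s.1 s.2.1 then some (s.1, s.2.1)
    else none)

/-- The column of the ⌐-turn of pipe `c` in row `row`, if any. -/
def seTurnCol (g : Grid) (c row : ℕ) : Option ℕ :=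
  (pipePath g c).findSome? (fun s =>
    if s.1 = row ∧ s.2.2 = Dir.north ∧
        (g.tile s.1 s.2.1 = Tile.se ∨ g.tile s.1 s.2.1 = Tile.bump) then some s.2.1
    else none)

/-- The iteration of the Huang bump: min-droops and cross-bump-swaps until a bump tile
is turned into a crossing tile. -/
def huangLoop (iPipe : ℕ) : ℕ → Grid → ℕ × ℕ → Grid
  | 0, g, _ => g
  | fuel + 1, g, (x, y) =>
    let c := minDroopCorner g x y
    let g1 := minDroopT g x y
    match g1.tile c.1 c.2 with
    | Tile.nw =>
      match seTurnCol g1 iPipe c.1 with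
      | some col => huangLoop iPipe fuel g1 (c.1, col)
      | none => g1
    | Tile.bump =>
      match backAux g1 (2 * g1.n + 2) c.1 c.2 false with
      | some q =>
        match findCrossing g1 iPipe q with
        | some z =>
          huangLoop iPipe fuel (setTile (setTile g1 c.1 c.2 Tile.cross) z.1 z.2 Tile.bump) z
        | none => setTile g1 c.1 c.2 Tile.cross
      | none => g1
    | _ => g1

/-- Fuel exceeding the number of states of the procedure. -/
def huangFuel (g : Grid) : ℕ := 7 ^ (g.n * g.n) * (g.n * g.n) + 2

/-- The Huang bump `H_{ij}`: replace the crossing of pipes `i` and `j` by a bump tile,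
then repeatedly min-droop and cross-bump-swap until a new crossing tile is created. -/
def huang (i j : ℕ) (g : Grid) : Grid :=
  match findCrossing g i j with
  | some z => huangLoop i (huangFuel g) (setTile g z.1 z.2 Tile.bump) z
  | none => g

/-! ### Deleting a letter from a word -/

/-- Strong exchange: if `w` inverts the values `x < y`, then a word for `w` can be shortened
by one letter to a word for `t_{xy} w`. -/
lemma IsWord.exists_swap_mul {l : List ℕ} :
    ∀ {w : Perm'} {x y : ℕ}, IsWord w l → x < y → w.symm y < w.symm x →
      ∃ l', IsWord (Equiv.swap x y * w) l' ∧ l'.length + 1 = l.length := by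
  induction l with
  | nil =>
    rintro w x y ⟨-, rfl⟩ hxy h
    simp [wordProd, Equiv.Perm.one_def] at h
    omega
  | cons b l ih =>
    rintro w x y ⟨hl, rfl⟩ hxy h
    have hprod : wordProd (b :: l) = sT b * wordProd l := by simp [wordProd]
    have hb : 1 ≤ b := hl b (by simp)
    have hl' : ∀ z ∈ l, 1 ≤ z := fun z hz => hl z (by simp [hz])
    rw [hprod] at h ⊢
    by_cases hxb : x = b ∧ y = b + 1
    · obtain ⟨rfl, rfl⟩ := hxb
      refine ⟨l, ⟨hl', ?_⟩, by simp⟩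
      rw [sT, ← mul_assoc, Equiv.swap_mul_self, one_mul]
    · have hsymm : ∀ z, (sT b * wordProd l).symm z = (wordProd l).symm (sT b z) := by
        intro z
        rw [Equiv.symm_apply_eq, Equiv.Perm.mul_apply, Equiv.apply_symm_apply, sT,
          Equiv.swap_apply_self]
      rw [hsymm, hsymm] at h
      have hlt : sT b x < sT b y := by
        simp only [sT, Equiv.swap_apply_def]
        split_ifs <;> omega
      obtain ⟨l', ⟨h1, h2⟩, h3⟩ := ih ⟨hl', rfl⟩ hlt h
      refine ⟨b :: l', ⟨?_, ?_⟩, by simpa using h3⟩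
      · intro z hz
        rcases List.mem_cons.1 hz with rfl | hz
        · exact hb
        · exact h1 z hz
      · have h4 : sT b * Equiv.swap (sT b x) (sT b y) = Equiv.swap x y * sT b := by
          have := Equiv.mul_swap_eq_swap_mul (sT b) (sT b x) (sT b y)
          rw [this]
          simp [sT]
        have h5 : wordProd (b :: l') = sT b * wordProd l' := by simp [wordProd]
        rw [h5, h2, ← mul_assoc, h4, mul_assoc]

lemma plen_sT_mul {w : Perm'} {a : ℕ} (ha : 1 ≤ a) (hl : 1 ≤ plen w)
    (h : w.symm (a + 1) < w.symm a) : plen (sT a * w) + 1 = plen w := by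
  have hne : {m | ∃ l : List ℕ, IsWord w l ∧ l.length = m}.Nonempty := by
    by_contra hne
    rw [Set.not_nonempty_iff_eq_empty] at hne
    simp [plen, hne] at hl
  obtain ⟨l, hlw, hlen⟩ := Nat.sInf_mem hne
  obtain ⟨l', hl', hlen'⟩ := hlw.exists_swap_mul (Nat.lt_succ_self a) h
  have hmem : l'.length ∈ {m | ∃ l : List ℕ, IsWord (sT a * w) l ∧ l.length = m} :=
    ⟨l', hl', rfl⟩
  have h1 : plen (sT a * w) ≤ l'.length := Nat.sInf_le hmem
  obtain ⟨l₂, hl₂, hlen₂⟩ := Nat.sInf_mem ⟨_, hmem⟩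
  have h2 : plen w ≤ l₂.length + 1 := by
    refine Nat.sInf_le ⟨a :: l₂, ⟨?_, ?_⟩, by simp⟩
    · intro z hz
      rcases List.mem_cons.1 hz with rfl | hz
      · exact ha
      · exact hl₂.1 z hz
    · have : wordProd (a :: l₂) = sT a * wordProd l₂ := by simp [wordProd]
      rw [this, hl₂.2, ← mul_assoc, sT, Equiv.swap_mul_self, one_mul]
  change l.length = plen w at hlen
  change l₂.length = plen (sT a * w) at hlen₂
  omega

/-! ### Tilings and edge labelings -/

/-- The local conditions in the definition of a bumpless pipe dream. -/
structure IsTiling (g : Grid) : Prop where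
  pos : 1 ≤ g.n
  outside : ∀ i j, ¬ InGrid g i j → g.tile i j = Tile.horiz
  no_bump : ∀ i j, InGrid g i j → g.tile i j ≠ Tile.bump
  match_v : ∀ i j, 1 ≤ i → i < g.n → 1 ≤ j → j ≤ g.n →
    hasS (g.tile i j) = hasN (g.tile (i + 1) j)
  match_h : ∀ i j, 1 ≤ i → i ≤ g.n → 1 ≤ j → j < g.n →
    hasE (g.tile i j) = hasW (g.tile i (j + 1))
  top : ∀ j, 1 ≤ j → j ≤ g.n → hasN (g.tile 1 j) = false
  bot : ∀ j, 1 ≤ j → j ≤ g.n → hasS (g.tile g.n j) = true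
  left : ∀ i, 1 ≤ i → i ≤ g.n → hasW (g.tile i 1) = false
  right : ∀ i, 1 ≤ i → i ≤ g.n → hasE (g.tile i g.n) = true

/-- A labeling of the edges of a grid by pipes: `V x y` is the label of the south edge of the
tile `(x, y)` and `H x y` the label of its east edge (meaningful if a pipe crosses that edge). -/
structure IsLabeling (g : Grid) (V H : ℕ → ℕ → ℕ) : Prop where
  bottom : ∀ y, 1 ≤ y → y ≤ g.n → V g.n y = y
  north : ∀ x y, InGrid g x y → g.tile x y = .vert ∨ g.tile x y = .cross → V (x - 1) y = V x y
  east : ∀ x y, InGrid g x y → g.tile x y = .horiz ∨ g.tile x y = .cross → H x y = H x (y - 1)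
  se : ∀ x y, InGrid g x y → g.tile x y = .se → H x y = V x y
  nw : ∀ x y, InGrid g x y → g.tile x y = .nw → V (x - 1) y = H x (y - 1)

/-- The labels of the east edges of a row with tiles `t` and south edge labels `v`. -/
def rowLabel (t : ℕ → Tile) (v : ℕ → ℕ) : ℕ → ℕ
  | 0 => 0
  | y + 1 => match t (y + 1) with
    | .se => v (y + 1)
    | _ => rowLabel t v y

/-- The labels of the horizontal edges at height `m` above the bottom of the grid. -/
def heightLabel (g : Grid) : ℕ → ℕ → ℕ
  | 0, y => y
  | m + 1, y => match g.tile (g.n - m) y with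
    | .nw => rowLabel (g.tile (g.n - m)) (heightLabel g m) (y - 1)
    | _ => heightLabel g m y

lemma exists_isLabeling (g : Grid) : ∃ V H, IsLabeling g V H := by
  refine ⟨fun x y => heightLabel g (g.n - x) y,
    fun x y => rowLabel (g.tile x) (heightLabel g (g.n - x)) y, ?_, ?_, ?_, ?_, ?_⟩
  · intro y _ _
    simp [heightLabel]
  · rintro x y ⟨h1, h2, h3, h4⟩ h
    have e : g.n - (x - 1) = (g.n - x) + 1 := by omega
    have e' : g.n - (g.n - x) = x := by omega
    simp only [e, heightLabel, e']
    rcases h with h | h <;> simp [h]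
  · rintro x y ⟨h1, h2, h3, h4⟩ h
    obtain ⟨y, rfl⟩ : ∃ z, y = z + 1 := ⟨y - 1, by omega⟩
    rcases h with h | h <;> simp [rowLabel, h]
  · rintro x y ⟨h1, h2, h3, h4⟩ h
    obtain ⟨y, rfl⟩ : ∃ z, y = z + 1 := ⟨y - 1, by omega⟩
    simp [rowLabel, h]
  · rintro x y ⟨h1, h2, h3, h4⟩ h
    have e : g.n - (x - 1) = (g.n - x) + 1 := by omega
    have e' : g.n - (g.n - x) = x := by omega
    simp only [e, heightLabel, e']
    simp [h]

/-- Labels are bounded by the column index. -/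
lemma IsLabeling.bounds {g : Grid} {V H : ℕ → ℕ → ℕ} (hg : IsTiling g) (hL : IsLabeling g V H) :
    ∀ L x y, InGrid g x y → g.n - x + y = L →
      (hasS (g.tile x y) = true → 1 ≤ V x y ∧ V x y ≤ y) ∧
      (hasE (g.tile x y) = true → 1 ≤ H x y ∧ H x y ≤ y) := by
  intro L
  induction L using Nat.strong_induction_on with
  | _ L ih =>
  rintro x y hxy rfl
  obtain ⟨h1, h2, h3, h4⟩ := id hxy
  have hV : hasS (g.tile x y) = true → 1 ≤ V x y ∧ V x y ≤ y := by
    intro hS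
    rcases Nat.lt_or_ge x g.n with hx | hx
    · rw [hg.match_v x y h1 hx h3 h4] at hS
      have hin : InGrid g (x + 1) y := ⟨by omega, by omega, h3, h4⟩
      have hnb := hg.no_bump _ _ hin
      have key := hL.north _ _ hin
      have key' := hL.nw _ _ hin
      rw [Nat.add_sub_cancel] at key key'
      rcases ht : g.tile (x + 1) y with _ | _ | _ | _ | _ | _ | _ <;> simp [ht, hasN] at hS hnb
      · rw [key (by simp [ht])]
        exact (ih _ (by omega) (x + 1) y hin rfl).1 (by simp [ht, hasS])
      · rw [key' ht]
        have hy : y ≠ 1 := by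
          rintro rfl
          have := hg.left (x + 1) (by omega) (by omega)
          simp [ht, hasW] at this
        have hin' : InGrid g (x + 1) (y - 1) := ⟨by omega, by omega, by omega, by omega⟩
        have hm := hg.match_h (x + 1) (y - 1) (by omega) (by omega) (by omega) (by omega)
        rw [Nat.sub_add_cancel h3, ht] at hm
        have := (ih _ (by omega) (x + 1) (y - 1) hin' rfl).2 hm
        omega
      · rw [key (by simp [ht])]
        exact (ih _ (by omega) (x + 1) y hin rfl).1 (by simp [ht, hasS])
    · obtain rfl : x = g.n := by omega
      rw [hL.bottom y h3 h4]
      omega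
  refine ⟨hV, fun hE => ?_⟩
  have hstep : hasW (g.tile x y) = true → 1 ≤ H x (y - 1) ∧ H x (y - 1) ≤ y := by
    intro hW
    have hy : y ≠ 1 := by
      rintro rfl
      simp [hg.left x h1 h2] at hW
    have hin' : InGrid g x (y - 1) := ⟨by omega, by omega, by omega, by omega⟩
    have hm := hg.match_h x (y - 1) (by omega) (by omega) (by omega) (by omega)
    rw [Nat.sub_add_cancel h3, hW] at hm
    have := (ih _ (by omega) x (y - 1) hin' rfl).2 hm
    omega
  have hnb := hg.no_bump _ _ hxy
  rcases ht : g.tile x y with _ | _ | _ | _ | _ | _ | _ <;> simp [ht, hasE] at hE hnb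
  · rw [hL.east x y hxy (by simp [ht])]
    exact hstep (by simp [ht, hasW])
  · rw [hL.se x y hxy ht]
    exact hV (by simp [ht, hasS])
  · rw [hL.east x y hxy (by simp [ht])]
    exact hstep (by simp [ht, hasW])

section Labeling

variable {g : Grid} {V H : ℕ → ℕ → ℕ}

lemma IsLabeling.V_bounds (hL : IsLabeling g V H) (hg : IsTiling g) {x y : ℕ}
    (h : InGrid g x y) (hS : hasS (g.tile x y) = true) : 1 ≤ V x y ∧ V x y ≤ y :=
  (hL.bounds hg _ x y h rfl).1 hS

lemma IsLabeling.H_bounds (hL : IsLabeling g V H) (hg : IsTiling g) {x y : ℕ}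
    (h : InGrid g x y) (hE : hasE (g.tile x y) = true) : 1 ≤ H x y ∧ H x y ≤ y :=
  (hL.bounds hg _ x y h rfl).2 hE

/-- A tile with a west edge is not in the first column, and its left neighbour has an
east edge. -/
lemma IsTiling.of_hasW (hg : IsTiling g) {x y : ℕ} (h : InGrid g x y)
    (hW : hasW (g.tile x y) = true) :
    2 ≤ y ∧ InGrid g x (y - 1) ∧ hasE (g.tile x (y - 1)) = true := by
  obtain ⟨h1, h2, h3, h4⟩ := h
  have hy : y ≠ 1 := by
    rintro rfl
    simp [hg.left x h1 h2] at hW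
  have hm := hg.match_h x (y - 1) (by omega) (by omega) (by omega) (by omega)
  rw [Nat.sub_add_cancel h3, hW] at hm
  exact ⟨by omega, ⟨h1, h2, by omega, by omega⟩, hm⟩

/-- A tile with a north edge is not in the first row, and its upper neighbour has a
south edge. -/
lemma IsTiling.of_hasN (hg : IsTiling g) {x y : ℕ} (h : InGrid g x y)
    (hN : hasN (g.tile x y) = true) :
    2 ≤ x ∧ InGrid g (x - 1) y ∧ hasS (g.tile (x - 1) y) = true := by
  obtain ⟨h1, h2, h3, h4⟩ := h
  have hx : x ≠ 1 := by
    rintro rfl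
    simp [hg.top y h3 h4] at hN
  have hm := hg.match_v (x - 1) y (by omega) (by omega) (by omega) (by omega)
  rw [Nat.sub_add_cancel h1, hN] at hm
  exact ⟨by omega, ⟨by omega, by omega, h3, h4⟩, hm⟩

/-- Tracing a pipe backwards computes its label. -/
lemma IsLabeling.backAux_eq (hL : IsLabeling g V H) (hg : IsTiling g) :
    ∀ f x y, InGrid g x y → g.n - x + y < f →
      (hasN (g.tile x y) = true → backAux g f x y true = some (V (x - 1) y)) ∧
      (hasE (g.tile x y) = true → backAux g f x y false = some (H x y)) := by
  intro f
  induction f with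
  | zero => intro x y _ h; omega
  | succ f ih =>
    intro x y hxy hf
    obtain ⟨h1, h2, h3, h4⟩ := id hxy
    have hnb := hg.no_bump _ _ hxy
    have hdown : hasS (g.tile x y) = true →
        (if x = g.n then some y else backAux g f (x + 1) y true) = some (V x y) := by
      intro hS
      split_ifs with hx
      · rw [hx, hL.bottom y h3 h4]
      · rw [hg.match_v x y h1 (by omega) h3 h4] at hS
        exact (ih (x + 1) y ⟨by omega, by omega, h3, h4⟩ (by omega)).1 hS
    have hleft : hasW (g.tile x y) = true →
        backAux g f x (y - 1) false = some (H x (y - 1)) := by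
      intro hW
      obtain ⟨hy, hin, hE⟩ := hg.of_hasW hxy hW
      exact (ih x (y - 1) hin (by omega)).2 hE
    have hle : ¬ g.n < x := by omega
    constructor
    · intro hN
      rcases ht : g.tile x y with _ | _ | _ | _ | _ | _ | _ <;> simp [ht, hasN] at hN hnb
      · rw [hL.north x y hxy (by simp [ht]), ← hdown (by simp [ht, hasS])]
        simp [backAux, ht, hle]
      · rw [hL.nw x y hxy ht, ← hleft (by simp [ht, hasW])]
        simp [backAux, ht, hle]
      · rw [hL.north x y hxy (by simp [ht]), ← hdown (by simp [ht, hasS])]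
        simp [backAux, ht, hle]
    · intro hE
      rcases ht : g.tile x y with _ | _ | _ | _ | _ | _ | _ <;> simp [ht, hasE] at hE hnb
      · rw [hL.east x y hxy (by simp [ht]), ← hleft (by simp [ht, hasW])]
        simp [backAux, ht, hle]
      · rw [hL.se x y hxy ht, ← hdown (by simp [ht, hasS])]
        simp [backAux, ht, hle]
      · rw [hL.east x y hxy (by simp [ht]), ← hleft (by simp [ht, hasW])]
        simp [backAux, ht, hle]

lemma IsLabeling.pipeFromS_eq (hL : IsLabeling g V H) (hg : IsTiling g) {x y : ℕ}
    (h : InGrid g x y) (hS : hasS (g.tile x y) = true) : pipeFromS g x y = some (V x y) := by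
  obtain ⟨h1, h2, h3, h4⟩ := h
  rw [pipeFromS]
  split_ifs with hx
  · rw [hx, hL.bottom y h3 h4]
  · rw [hg.match_v x y h1 (by omega) h3 h4] at hS
    have := (hL.backAux_eq hg (2 * g.n + 2) (x + 1) y ⟨by omega, by omega, h3, h4⟩
      (by omega)).1 hS
    simpa using this

/-! ### Pipes as sets of states -/

/-- The pipe labeled `c` traverses the tile `(x, y)` with incoming heading `d`. -/
def OnState (g : Grid) (V H : ℕ → ℕ → ℕ) (c x y : ℕ) (d : Dir) : Prop :=
  InGrid g x y ∧ ((d = .north ∧ hasS (g.tile x y) = true ∧ V x y = c) ∨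
    (d = .east ∧ hasW (g.tile x y) = true ∧ H x (y - 1) = c))

lemma OnState.out (hL : IsLabeling g V H) (hg : IsTiling g) {c x y : ℕ} {d : Dir}
    (h : OnState g V H c x y d) :
    (outDir (g.tile x y) d = some .north ∧ 2 ≤ x ∧ OnState g V H c (x - 1) y .north) ∨
    (outDir (g.tile x y) d = some .east ∧ H x y = c ∧
      (y < g.n → OnState g V H c x (y + 1) .east)) := by
  obtain ⟨hxy, h⟩ := h
  obtain ⟨h1, h2, h3, h4⟩ := id hxy
  have hnb := hg.no_bump _ _ hxy
  have hup : hasN (g.tile x y) = true → V (x - 1) y = c →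
      2 ≤ x ∧ OnState g V H c (x - 1) y .north := by
    intro hN hV
    obtain ⟨hx, hin, hS⟩ := hg.of_hasN hxy hN
    exact ⟨hx, hin, Or.inl ⟨rfl, hS, hV⟩⟩
  have hright : hasE (g.tile x y) = true → H x y = c →
      H x y = c ∧ (y < g.n → OnState g V H c x (y + 1) .east) := by
    intro hE hH
    refine ⟨hH, fun hy => ⟨⟨h1, h2, by omega, by omega⟩, Or.inr ⟨rfl, ?_, by simpa using hH⟩⟩⟩
    rw [← hg.match_h x y h1 h2 h3 hy, hE]
  rcases h with ⟨rfl, hS, hc⟩ | ⟨rfl, hW, hc⟩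
  · rcases ht : g.tile x y with _ | _ | _ | _ | _ | _ | _ <;> simp [ht, hasS] at hS hnb
    · exact Or.inl ⟨rfl, hup (by simp [ht, hasN]) (by rw [hL.north x y hxy (by simp [ht]), hc])⟩
    · exact Or.inr ⟨rfl, hright (by simp [ht, hasE]) (by rw [hL.se x y hxy ht, hc])⟩
    · exact Or.inl ⟨rfl, hup (by simp [ht, hasN]) (by rw [hL.north x y hxy (by simp [ht]), hc])⟩
  · rcases ht : g.tile x y with _ | _ | _ | _ | _ | _ | _ <;> simp [ht, hasW] at hW hnb
    · exact Or.inr ⟨rfl, hright (by simp [ht, hasE]) (by rw [hL.east x y hxy (by simp [ht]), hc])⟩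
    · exact Or.inl ⟨rfl, hup (by simp [ht, hasN]) (by rw [hL.nw x y hxy ht, hc])⟩
    · exact Or.inr ⟨rfl, hright (by simp [ht, hasE]) (by rw [hL.east x y hxy (by simp [ht]), hc])⟩

lemma OnState.trace (hL : IsLabeling g V H) (hg : IsTiling g) {c : ℕ} :
    ∀ f {x y : ℕ} {d : Dir}, OnState g V H c x y d → x + (g.n - y) < f →
      ∃ r, traceAux g f x y d = some r ∧ 1 ≤ r ∧ r ≤ g.n ∧ H r g.n = c := by
  intro f
  induction f with
  | zero => intro x y d _ h; omega
  | succ f ih =>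
    intro x y d h hf
    obtain ⟨h1, h2, h3, h4⟩ := h.1
    rcases h.out hL hg with ⟨ho, hx, hs⟩ | ⟨ho, hH, hs⟩
    · obtain ⟨r, hr, hr'⟩ := ih hs (by omega)
      exact ⟨r, by simp [traceAux, ho, show ¬ x ≤ 1 by omega, hr], hr'⟩
    · rcases Nat.lt_or_ge y g.n with hy | hy
      · obtain ⟨r, hr, hr'⟩ := ih (hs hy) (by omega)
        exact ⟨r, by simp [traceAux, ho, show ¬ g.n ≤ y by omega, hr], hr'⟩
      · obtain rfl : y = g.n := by omega
        exact ⟨x, by simp [traceAux, ho], h1, h2, hH⟩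

lemma OnState.bottom (hL : IsLabeling g V H) (hg : IsTiling g) {c : ℕ} (h1 : 1 ≤ c)
    (h2 : c ≤ g.n) : OnState g V H c g.n c .north :=
  ⟨⟨hg.pos, le_rfl, h1, h2⟩, Or.inl ⟨rfl, hg.bot c h1 h2, hL.bottom c h1 h2⟩⟩

lemma exitRow_spec (hL : IsLabeling g V H) (hg : IsTiling g) {c : ℕ} (h1 : 1 ≤ c)
    (h2 : c ≤ g.n) : ∃ r, exitRow g c = some r ∧ 1 ≤ r ∧ r ≤ g.n ∧ H r g.n = c :=
  (OnState.bottom hL hg h1 h2).trace hL hg _ (by omega)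

lemma onState_of_mem_pathAux (hL : IsLabeling g V H) (hg : IsTiling g) {c : ℕ} :
    ∀ f {x y x₀ y₀ : ℕ} {d d₀ : Dir}, OnState g V H c x₀ y₀ d₀ →
      (x, y, d) ∈ pathAux g f x₀ y₀ d₀ → OnState g V H c x y d := by
  intro f
  induction f with
  | zero => intro x y x₀ y₀ d d₀ _ h; simp [pathAux] at h
  | succ f ih =>
    intro x y x₀ y₀ d d₀ hs h
    rw [pathAux, List.mem_cons] at h
    rcases h with h | h
    · simp only [Prod.mk.injEq] at h
      obtain ⟨rfl, rfl, rfl⟩ := h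
      exact hs
    · rcases hs.out hL hg with ⟨ho, hx, hs⟩ | ⟨ho, hH, hs⟩
      · simp only [ho, show ¬ x₀ ≤ 1 by omega, if_false] at h
        exact ih hs h
      · simp only [ho] at h
        split_ifs at h with hy
        · simp at h
        · exact ih (hs (by omega)) h

lemma mem_pathAux_next {f : ℕ} : ∀ {x y x₀ y₀ : ℕ} {d d₀ : Dir},
    x₀ + (g.n - y₀) < f → (x, y, d) ∈ pathAux g f x₀ y₀ d₀ →
    (outDir (g.tile x y) d = some .north → 2 ≤ x →
      (x - 1, y, Dir.north) ∈ pathAux g f x₀ y₀ d₀) ∧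
    (outDir (g.tile x y) d = some .east → y < g.n →
      (x, y + 1, Dir.east) ∈ pathAux g f x₀ y₀ d₀) := by
  induction f with
  | zero => intro x y x₀ y₀ d d₀ h; omega
  | succ f ih =>
    intro x y x₀ y₀ d d₀ hf h
    have hhead : ∀ {a b : ℕ} {e : Dir}, 0 < f → (a, b, e) ∈ pathAux g f a b e := by
      intro a b e hf
      obtain ⟨f, rfl⟩ : ∃ k, f = k + 1 := ⟨f - 1, by omega⟩
      simp [pathAux]
    rw [pathAux, List.mem_cons] at h
    rcases h with h | h
    · simp only [Prod.mk.injEq] at h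
      obtain ⟨rfl, rfl, rfl⟩ := h
      constructor
      · intro ho hx
        rw [pathAux]
        simp only [ho, show ¬ x ≤ 1 by omega, if_false]
        exact List.mem_cons_of_mem _ (hhead (by omega))
      · intro ho hy
        rw [pathAux]
        simp only [ho, show ¬ g.n ≤ y by omega, if_false]
        exact List.mem_cons_of_mem _ (hhead (by omega))
    · rw [pathAux]
      split at h
      · simp at h
      · split_ifs at h with hx
        · simp at h
        · simp only [hx, if_false, List.mem_cons]
          have := ih (by omega) h
          exact ⟨fun a b => Or.inr (this.1 a b), fun a b => Or.inr (this.2 a b)⟩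
      · split_ifs at h with hy
        · simp at h
        · simp only [hy, if_false, List.mem_cons]
          have := ih (by omega) h
          exact ⟨fun a b => Or.inr (this.1 a b), fun a b => Or.inr (this.2 a b)⟩

lemma mem_pipePath_of_onState (hL : IsLabeling g V H) (hg : IsTiling g) {c : ℕ} :
    ∀ L x y d, OnState g V H c x y d → g.n - x + y = L → (x, y, d) ∈ pipePath g c := by
  intro L
  induction L using Nat.strong_induction_on with
  | _ L ih =>
  rintro x y d ⟨hxy, h⟩ rfl
  obtain ⟨h1, h2, h3, h4⟩ := id hxy
  have hfuel : g.n + (g.n - c) < 2 * g.n + 2 := by omega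
  rcases h with ⟨rfl, hS, hc⟩ | ⟨rfl, hW, hc⟩
  · rcases Nat.lt_or_ge x g.n with hx | hx
    · have hN := hS
      rw [hg.match_v x y h1 hx h3 h4] at hN
      have hin : InGrid g (x + 1) y := ⟨by omega, by omega, h3, h4⟩
      have hnb := hg.no_bump _ _ hin
      have key := hL.north _ _ hin
      have key' := hL.nw _ _ hin
      rw [Nat.add_sub_cancel, hc] at key key'
      have hfin : ∀ d, outDir (g.tile (x + 1) y) d = some .north →
          OnState g V H c (x + 1) y d → (x, y, Dir.north) ∈ pipePath g c := by
        intro d ho hs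
        have := ih _ (by omega) _ _ _ hs rfl
        simpa [pipePath] using (mem_pathAux_next hfuel this).1 ho (by omega)
      rcases ht : g.tile (x + 1) y with _ | _ | _ | _ | _ | _ | _ <;> simp [ht, hasN] at hN hnb
      · exact hfin .north (by simp [ht, outDir])
          ⟨hin, Or.inl ⟨rfl, by simp [ht, hasS], (key (by simp [ht])).symm⟩⟩
      · exact hfin .east (by simp [ht, outDir])
          ⟨hin, Or.inr ⟨rfl, by simp [ht, hasW], (key' ht).symm⟩⟩
      · exact hfin .north (by simp [ht, outDir])
          ⟨hin, Or.inl ⟨rfl, by simp [ht, hasS], (key (by simp [ht])).symm⟩⟩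
    · obtain rfl : x = g.n := by omega
      rw [hL.bottom y h3 h4] at hc
      subst hc
      simp [pipePath, pathAux]
  · obtain ⟨hy, hin, hE⟩ := hg.of_hasW hxy hW
    have hnb := hg.no_bump _ _ hin
    have hfin : ∀ d, outDir (g.tile x (y - 1)) d = some .east →
        OnState g V H c x (y - 1) d → (x, y, Dir.east) ∈ pipePath g c := by
      intro d ho hs
      have := ih _ (by omega) _ _ _ hs rfl
      have := (mem_pathAux_next hfuel this).2 ho (by omega)
      rwa [Nat.sub_add_cancel h3] at this
    rcases ht : g.tile x (y - 1) with _ | _ | _ | _ | _ | _ | _ <;> simp [ht, hasE] at hE hnb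
    · exact hfin .east (by simp [ht, outDir])
        ⟨hin, Or.inr ⟨rfl, by simp [ht, hasW], by rw [← hL.east x _ hin (by simp [ht]), hc]⟩⟩
    · exact hfin .north (by simp [ht, outDir])
        ⟨hin, Or.inl ⟨rfl, by simp [ht, hasS], by rw [← hL.se x _ hin ht, hc]⟩⟩
    · exact hfin .east (by simp [ht, outDir])
        ⟨hin, Or.inr ⟨rfl, by simp [ht, hasW], by rw [← hL.east x _ hin (by simp [ht]), hc]⟩⟩

lemma pathAux_advance {f : ℕ} : ∀ {x y x₀ y₀ : ℕ} {d d₀ : Dir},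
    (x, y, d) ∈ pathAux g f x₀ y₀ d₀ → (x = x₀ ∧ y = y₀ ∧ d = d₀) ∨ x + y₀ < x₀ + y := by
  induction f with
  | zero => intro x y x₀ y₀ d d₀ h; simp [pathAux] at h
  | succ f ih =>
    intro x y x₀ y₀ d d₀ h
    rw [pathAux, List.mem_cons] at h
    rcases h with h | h
    · left
      simpa using h
    · right
      split at h
      · simp at h
      · split_ifs at h with hx
        · simp at h
        · have := ih h
          omega
      · split_ifs at h with hx
        · simp at h
        · have := ih h
          omega

lemma pathAux_unique {f : ℕ} : ∀ {x y x' y' x₀ y₀ : ℕ} {d d' d₀ : Dir},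
    (x, y, d) ∈ pathAux g f x₀ y₀ d₀ → (x', y', d') ∈ pathAux g f x₀ y₀ d₀ →
    x + y' = x' + y → x = x' ∧ y = y' ∧ d = d' := by
  induction f with
  | zero => intro x y x' y' x₀ y₀ d d' d₀ h; simp [pathAux] at h
  | succ f ih =>
    intro x y x' y' x₀ y₀ d d' d₀ h h' hxy
    rcases pathAux_advance h with ⟨rfl, rfl, rfl⟩ | hlt
    · rcases pathAux_advance h' with ⟨rfl, rfl, rfl⟩ | hlt'
      · simp
      · omega
    · rcases pathAux_advance h' with ⟨rfl, rfl, rfl⟩ | hlt'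
      · omega
      · rw [pathAux, List.mem_cons] at h h'
        rcases h with h | h
        · simp only [Prod.mk.injEq] at h
          omega
        rcases h' with h' | h'
        · simp only [Prod.mk.injEq] at h'
          omega
        split at h
        · simp at h
        · rename_i ho
          simp only [ho] at h'
          split_ifs at h h' with hx
          · simp at h
          · exact ih h h' hxy
        · rename_i ho
          simp only [ho] at h'
          split_ifs at h h' with hx
          · simp at h
          · have hpair := ih h h' hxy
            exact hpair

/-- A pipe meets each diagonal in at most one state. -/
lemma OnState.unique (hL : IsLabeling g V H) (hg : IsTiling g) {c x y x' y' : ℕ} {d d' : Dir}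
    (h : OnState g V H c x y d) (h' : OnState g V H c x' y' d') (hxy : x + y' = x' + y) :
    x = x' ∧ y = y' ∧ d = d' :=
  pathAux_unique (mem_pipePath_of_onState hL hg _ _ _ _ h rfl)
    (mem_pipePath_of_onState hL hg _ _ _ _ h' rfl) hxy

lemma onState_north_of_cross {x y : ℕ} (h : InGrid g x y) (ht : g.tile x y = .cross) :
    OnState g V H (V x y) x y .north :=
  ⟨h, Or.inl ⟨rfl, by simp [ht, hasS], rfl⟩⟩

lemma onState_east_of_cross {x y : ℕ} (h : InGrid g x y) (ht : g.tile x y = .cross) :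
    OnState g V H (H x (y - 1)) x y .east :=
  ⟨h, Or.inr ⟨rfl, by simp [ht, hasW], rfl⟩⟩

/-- The two pipes at a crossing are distinct. -/
lemma IsLabeling.ne_of_cross (hL : IsLabeling g V H) (hg : IsTiling g) {x y : ℕ}
    (h : InGrid g x y) (ht : g.tile x y = .cross) : V x y ≠ H x (y - 1) := by
  intro he
  have h1 := onState_north_of_cross (V := V) (H := H) h ht
  have h2 := onState_east_of_cross (V := V) (H := H) h ht
  rw [← he] at h2
  simpa using (h1.unique hL hg h2 rfl).2.2

/-- No two crossings involve the same pair of labels. -/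
def IsReducedLabeling (g : Grid) (V H : ℕ → ℕ → ℕ) : Prop :=
  ∀ x y x' y', InGrid g x y → InGrid g x' y' → g.tile x y = .cross → g.tile x' y' = .cross →
    ((V x y = V x' y' ∧ H x (y - 1) = H x' (y' - 1)) ∨
      (V x y = H x' (y' - 1) ∧ H x (y - 1) = V x' y')) → x = x' ∧ y = y'

lemma IsBPD.isTiling (h : IsBPD g) : IsTiling g :=
  ⟨h.1, h.2.1, h.2.2.1, h.2.2.2.1, h.2.2.2.2.1, h.2.2.2.2.2.1, h.2.2.2.2.2.2.1,
    h.2.2.2.2.2.2.2.1, h.2.2.2.2.2.2.2.2.1⟩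

lemma OnState.passes (hL : IsLabeling g V H) (hg : IsTiling g) {c x y : ℕ} {d : Dir}
    (h : OnState g V H c x y d) : passes g c (x, y) :=
  ⟨d, mem_pipePath_of_onState hL hg _ _ _ _ h rfl⟩

lemma IsBPD.isReducedLabeling (h : IsBPD g) (hL : IsLabeling g V H) :
    IsReducedLabeling g V H := by
  have hg := h.isTiling
  intro x y x' y' hin hin' ht ht' hpair
  have hne := hL.ne_of_cross hg hin ht
  have hV := hL.V_bounds hg hin (by simp [ht, hasS])
  have hHW := hg.of_hasW hin (by simp [ht, hasW])
  have hH := hL.H_bounds hg hHW.2.1 hHW.2.2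
  obtain ⟨-, -, h3, h4⟩ := id hin
  have hsub := h.2.2.2.2.2.2.2.2.2 (V x y) (H x (y - 1)) hV.1 (by omega) hH.1 (by omega) hne
  have hn := onState_north_of_cross (V := V) (H := H) hin ht
  have he := onState_east_of_cross (V := V) (H := H) hin ht
  have hn' := onState_north_of_cross (V := V) (H := H) hin' ht'
  have he' := onState_east_of_cross (V := V) (H := H) hin' ht'
  have hz : (x, y) = (x', y') := by
    refine hsub ⟨ht, hn.passes hL hg, he.passes hL hg⟩ ⟨ht', ?_⟩
    rcases hpair with ⟨e1, e2⟩ | ⟨e1, e2⟩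
    · rw [e1, e2]
      exact ⟨hn'.passes hL hg, he'.passes hL hg⟩
    · rw [e1, e2]
      exact ⟨he'.passes hL hg, hn'.passes hL hg⟩
  simpa using hz

lemma IsTiling.isBPD (hg : IsTiling g) (hL : IsLabeling g V H) (hR : IsReducedLabeling g V H) :
    IsBPD g := by
  refine ⟨hg.1, hg.2, hg.3, hg.4, hg.5, hg.6, hg.7, hg.8, hg.9, ?_⟩
  rintro c c' hc1 hc2 hc1' hc2' hne ⟨x, y⟩ ⟨ht, ⟨d, hd⟩, ⟨d', hd'⟩⟩ ⟨x', y'⟩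
    ⟨ht', ⟨e, he⟩, ⟨e', he'⟩⟩
  have hb := OnState.bottom hL hg hc1 hc2
  have hb' := OnState.bottom hL hg hc1' hc2'
  obtain ⟨hin, h1⟩ := onState_of_mem_pathAux hL hg _ hb hd
  obtain ⟨-, h2⟩ := onState_of_mem_pathAux hL hg _ hb' hd'
  obtain ⟨hin', h3⟩ := onState_of_mem_pathAux hL hg _ hb he
  obtain ⟨-, h4⟩ := onState_of_mem_pathAux hL hg _ hb' he'
  have := hR x y x' y' hin hin' ht ht' (by dsimp only at *; grind)
  simpa using this

lemma MemBPD.exit_label {w : Perm'} (h : MemBPD w g) (hL : IsLabeling g V H) {r : ℕ}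
    (h1 : 1 ≤ r) (h2 : r ≤ g.n) : H r g.n = w r := by
  obtain ⟨hB, h0, hfix, hexit⟩ := h
  have hr1 : 1 ≤ w r := by
    by_contra hlt
    have : w r = w 0 := by omega
    have := w.injective this
    omega
  have hr2 : w r ≤ g.n := by
    by_contra hlt
    have : w (w r) = w r := hfix _ (by omega)
    have := w.injective this
    omega
  obtain ⟨r', he, -, -, hH⟩ := exitRow_spec hL hB.isTiling hr1 hr2
  rw [hexit _ hr1 hr2, Equiv.symm_apply_apply] at he
  obtain rfl := Option.some.inj he
  exact hH

lemma memBPD_of_labeling {w : Perm'} (hg : IsTiling g) (hL : IsLabeling g V H)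
    (hR : IsReducedLabeling g V H) (h0 : w 0 = 0) (hfix : ∀ k, g.n < k → w k = k)
    (hH : ∀ r, 1 ≤ r → r ≤ g.n → H r g.n = w r) : MemBPD w g := by
  refine ⟨hg.isBPD hL hR, h0, hfix, fun c h1 h2 => ?_⟩
  obtain ⟨r, he, hr1, hr2, hr⟩ := exitRow_spec hL hg h1 h2
  rw [he, ← hr, hH r hr1 hr2, Equiv.symm_apply_apply]

end Labeling

section ColumnSwap

variable {g : Grid} {V H : ℕ → ℕ → ℕ} {i m j : ℕ}

/-! ### Vertical runs in a column -/

lemma IsLabeling.V_const (hL : IsLabeling g V H) {y a b : ℕ} (hab : a ≤ b) (hb : b ≤ g.n)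
    (h1 : 1 ≤ y) (h2 : y ≤ g.n)
    (h : ∀ t, a < t → t ≤ b → g.tile t y = .vert ∨ g.tile t y = .cross) : V a y = V b y := by
  induction b, hab using Nat.le_induction with
  | base => rfl
  | succ b hab ih =>
    rw [ih (by omega) (fun t h3 h4 => h t h3 (by omega))]
    have := hL.north (b + 1) y ⟨by omega, hb, h1, h2⟩ (h _ (by omega) le_rfl)
    simpa using this

/-- A pipe leaving a tile downwards and not reaching row `m` comes from a `⌟`-turn. -/
lemma IsTiling.exists_nw_below (hg : IsTiling g) {x : ℕ} (hx : 1 ≤ x) (hxm : x < m)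
    (hm : m ≤ g.n) (h1 : 1 ≤ j) (h2 : j ≤ g.n) (hS : hasS (g.tile x j) = true)
    (hN : hasN (g.tile m j) = false) :
    ∃ k, x < k ∧ k < m ∧ g.tile k j = .nw ∧
      ∀ t, x < t → t < k → g.tile t j = .vert ∨ g.tile t j = .cross := by
  induction hd : m - x generalizing x with
  | zero => omega
  | succ d ih =>
    have hin : InGrid g (x + 1) j := ⟨by omega, by omega, h1, h2⟩
    have hnb := hg.no_bump _ _ hin
    have hN' := hS
    rw [hg.match_v x j hx (by omega) h1 h2] at hN'
    have hne : x + 1 ≠ m := by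
      rintro rfl
      simp [hN'] at hN
    by_cases hnw : g.tile (x + 1) j = .nw
    · exact ⟨x + 1, by omega, by omega, hnw, fun t _ _ => by omega⟩
    · have hthru : g.tile (x + 1) j = .vert ∨ g.tile (x + 1) j = .cross := by
        rcases ht : g.tile (x + 1) j with _ | _ | _ | _ | _ | _ | _ <;> simp_all [hasN]
      obtain ⟨k, hk1, hk2, hk3, hk4⟩ := ih (x := x + 1) (by omega) (by omega)
        (by rcases hthru with h | h <;> simp [h, hasS]) (by omega)
      refine ⟨k, by omega, hk2, hk3, fun t ht1 ht2 => ?_⟩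
      rcases Nat.eq_or_lt_of_le ht1 with rfl | ht
      · exact hthru
      · exact hk4 t ht ht2

/-- A pipe leaving a tile upwards and not reaching row `i` ends in a `⌐`-turn. -/
lemma IsTiling.exists_se_above (hg : IsTiling g) {x : ℕ} (hi : 1 ≤ i) (hix : i < x)
    (hx : x ≤ g.n) (h1 : 1 ≤ j) (h2 : j ≤ g.n) (hN : hasN (g.tile x j) = true)
    (hS : hasS (g.tile i j) = false) :
    ∃ k, i < k ∧ k < x ∧ g.tile k j = .se ∧
      ∀ t, k < t → t < x → g.tile t j = .vert ∨ g.tile t j = .cross := by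
  induction hd : x - i generalizing x with
  | zero => omega
  | succ d ih =>
    obtain ⟨hx2, hin, hS'⟩ := hg.of_hasN ⟨by omega, hx, h1, h2⟩ hN
    have hnb := hg.no_bump _ _ hin
    have hne : x - 1 ≠ i := by
      rintro rfl
      simp [hS'] at hS
    by_cases hse : g.tile (x - 1) j = .se
    · exact ⟨x - 1, by omega, by omega, hse, fun t _ _ => by omega⟩
    · have hthru : g.tile (x - 1) j = .vert ∨ g.tile (x - 1) j = .cross := by
        rcases ht : g.tile (x - 1) j with _ | _ | _ | _ | _ | _ | _ <;> simp_all [hasS]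
      obtain ⟨k, hk1, hk2, hk3, hk4⟩ := ih (x := x - 1) (by omega) (by omega)
        (by rcases hthru with h | h <;> simp [h, hasN]) (by omega)
      refine ⟨k, hk1, by omega, hk3, fun t ht1 ht2 => ?_⟩
      rcases Nat.eq_or_lt_of_le (show t ≤ x - 1 by omega) with rfl | ht
      · exact hthru
      · exact hk4 t ht1 ht

/-! ### Exchanging a pipe in column `j + 1` with the contents of column `j` -/

/-- The pipe in column `j + 1`, between rows `i` and `m`, is moved to column `j`, and the part of
column `j` strictly between these rows is moved to column `j + 1`. If `m` exceeds the size of the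
grid, this is done down to the bottom. -/
def colSwap (g : Grid) (i m j : ℕ) : Grid := ⟨g.n, fun x y =>
  if y = j then
    if x = i then .se
    else if i < x ∧ x < m then (if hasW (g.tile x j) then .cross else .vert)
    else if x = m ∧ m ≤ g.n then (if hasS (g.tile x j) then .vert else .nw)
    else g.tile x y
  else if y = j + 1 then
    if x = i then (if hasN (g.tile x (j + 1)) then .nw else .horiz)
    else if i < x ∧ x < m then g.tile x j
    else if x = m ∧ m ≤ g.n then .blank
    else g.tile x y
  else g.tile x y⟩

/-- The hypotheses under which `colSwap` is meaningful. -/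
structure IsSwappable (g : Grid) (i m j : ℕ) : Prop where
  one_le_i : 1 ≤ i
  i_lt : i < m
  i_lt_n : i < g.n
  m_le : m ≤ g.n + 1
  one_le_j : 1 ≤ j
  j_lt : j < g.n
  blank : g.tile i j = .blank
  head : g.tile i (j + 1) = .se ∨ g.tile i (j + 1) = .vert
  through : ∀ x, i < x → x < m → g.tile x (j + 1) = .vert ∨ g.tile x (j + 1) = .cross
  foot : m ≤ g.n → g.tile m (j + 1) = .nw ∧ (g.tile m j = .horiz ∨ g.tile m j = .se)

lemma colSwap_n : (colSwap g i m j).n = g.n := rfl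

lemma colSwap_inGrid {x y : ℕ} : InGrid (colSwap g i m j) x y ↔ InGrid g x y := Iff.rfl

lemma colSwap_row_left : (colSwap g i m j).tile i j = .se := by simp [colSwap]

lemma colSwap_mid_left {x : ℕ} (h1 : i < x) (h2 : x < m) :
    (colSwap g i m j).tile x j = if hasW (g.tile x j) then .cross else .vert := by
  simp [colSwap, h1, h2, h1.ne']

lemma colSwap_mid_right {x : ℕ} (h1 : i < x) (h2 : x < m) :
    (colSwap g i m j).tile x (j + 1) = g.tile x j := by
  simp [colSwap, h1, h2, h1.ne']

lemma colSwap_foot_left (h : i < m) (hm : m ≤ g.n) :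
    (colSwap g i m j).tile m j = if hasS (g.tile m j) then .vert else .nw := by
  simp [colSwap, hm, h.ne']

lemma colSwap_foot_right (h : i < m) (hm : m ≤ g.n) :
    (colSwap g i m j).tile m (j + 1) = .blank := by
  simp [colSwap, hm, h.ne']

lemma colSwap_row_right :
    (colSwap g i m j).tile i (j + 1) = if hasN (g.tile i (j + 1)) then .nw else .horiz := by
  simp [colSwap]

lemma colSwap_of_col {x y : ℕ} (h : y ≠ j) (h' : y ≠ j + 1) :
    (colSwap g i m j).tile x y = g.tile x y := by
  simp [colSwap, h, h']

lemma colSwap_of_row {x y : ℕ} (hS : IsSwappable g i m j) (h : x < i ∨ m < x ∨ g.n < x) :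
    (colSwap g i m j).tile x y = g.tile x y := by
  have h1 := hS.i_lt
  have h2 := hS.i_lt_n
  have h3 := hS.m_le
  simp [colSwap, show x ≠ i by omega, show ¬ (i < x ∧ x < m) by omega,
    show ¬ (x = m ∧ m ≤ g.n) by omega]

lemma IsSwappable.isTiling (hS : IsSwappable g i m j) (hg : IsTiling g) :
    IsTiling (colSwap g i m j) := by
  obtain ⟨hi, him, hin, hm, hj, hjn, hbl, hhead, hthru, hfoot⟩ := id hS
  have hmidE : ∀ x, i < x → x < m → hasE (g.tile x (j + 1)) = hasE (g.tile x j) := by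
    intro x h1 h2
    rw [hg.match_h x j (by omega) (by omega) hj hjn]
    rcases hthru x h1 h2 with h | h <;> simp [h, hasE, hasW]
  have hmidS : ∀ x, i < x → x < m → hasS ((colSwap g i m j).tile x j) = true := by
    intro x h1 h2
    rw [colSwap_mid_left h1 h2]
    split_ifs <;> rfl
  have hmidN : ∀ x, i < x → x ≤ m → x ≤ g.n → hasN ((colSwap g i m j).tile x j) = true := by
    intro x h1 h2 h3
    rcases Nat.eq_or_lt_of_le h2 with rfl | h2
    · rw [colSwap_foot_left h1 h3]
      split_ifs <;> rfl
    · rw [colSwap_mid_left h1 h2]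
      split_ifs <;> rfl
  have hW : ∀ x, 1 ≤ x → x ≤ g.n →
      hasW ((colSwap g i m j).tile x j) = hasW (g.tile x j) := by
    intro x h1 h2
    rcases lt_trichotomy x i with h | rfl | h
    · rw [colSwap_of_row hS (by omega)]
    · rw [colSwap_row_left, hbl]
      rfl
    rcases lt_trichotomy x m with h' | rfl | h'
    · rw [colSwap_mid_left h h']
      split_ifs with h3
      · rw [h3]
        rfl
      · rw [Bool.not_eq_true] at h3
        rw [h3]
        rfl
    · rw [colSwap_foot_left h h2]
      rcases (hfoot h2).2 with h3 | h3 <;> simp [h3, hasW, hasS]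
    · rw [colSwap_of_row hS (by omega)]
  have hE : ∀ x, 1 ≤ x → x ≤ g.n →
      hasE ((colSwap g i m j).tile x (j + 1)) = hasE (g.tile x (j + 1)) := by
    intro x h1 h2
    rcases lt_trichotomy x i with h | rfl | h
    · rw [colSwap_of_row hS (by omega)]
    · rw [colSwap_row_right]
      rcases hhead with h3 | h3 <;> simp [h3, hasN, hasE]
    rcases lt_trichotomy x m with h' | rfl | h'
    · rw [colSwap_mid_right h h', hmidE x h h']
    · rw [colSwap_foot_right h h2, (hfoot h2).1]
      rfl
    · rw [colSwap_of_row hS (by omega)]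
  refine ⟨hg.pos, ?_, ?_, ?_, ?_, ?_, ?_, ?_, ?_⟩
  · intro x y hxy
    rw [colSwap_inGrid] at hxy
    have h := hg.outside x y hxy
    by_cases hy : y ≠ j ∧ y ≠ j + 1
    · rw [colSwap_of_col hy.1 hy.2, h]
    · rw [colSwap_of_row hS, h]
      unfold InGrid at hxy
      omega
  · intro x y hxy
    rw [colSwap_inGrid] at hxy
    have h := hg.no_bump x y hxy
    have h' := hg.no_bump x j ⟨hxy.1, hxy.2.1, hj, hjn.le⟩
    simp only [colSwap]
    split_ifs <;> simp [h, h']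
  · intro x y h1 h2 h3 h4
    rw [colSwap_n] at h2 h4
    by_cases hy : y ≠ j ∧ y ≠ j + 1
    · rw [colSwap_of_col hy.1 hy.2, colSwap_of_col hy.1 hy.2, hg.match_v x y h1 h2 h3 h4]
    have hv := hg.match_v x y h1 h2 h3 h4
    rcases show y = j ∨ y = j + 1 by omega with rfl | rfl
    · rcases lt_trichotomy x i with h | rfl | h
      · rw [colSwap_of_row hS (x := x) (by omega), hv]
        rcases Nat.eq_or_lt_of_le (show x + 1 ≤ i by omega) with rfl | h'
        · rw [colSwap_row_left, hbl]
          rfl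
        · rw [colSwap_of_row hS (by omega)]
      · rw [colSwap_row_left, hmidN (x + 1) (by omega) (by omega) (by omega)]
        rfl
      rcases lt_trichotomy x m with h' | rfl | h'
      · rw [hmidS x h h', hmidN (x + 1) (by omega) (by omega) (by omega)]
      · rw [colSwap_foot_left h h2.le, colSwap_of_row hS (by omega), ← hv]
        rcases (hfoot h2.le).2 with h3 | h3 <;> simp [h3, hasS]
      · rw [colSwap_of_row hS (by omega), colSwap_of_row hS (by omega), hv]
    · have hv' := hg.match_v x j h1 h2 hj hjn.le
      have hbelow : i ≤ x → x < m →
          hasN ((colSwap g i m j).tile (x + 1) (j + 1)) = hasN (g.tile (x + 1) j) := by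
        intro h5 h6
        rcases Nat.eq_or_lt_of_le (show x + 1 ≤ m by omega) with h7 | h7
        · subst h7
          rw [colSwap_foot_right (by omega) (by omega)]
          rcases (hfoot (by omega)).2 with h8 | h8 <;> simp [h8, hasN]
        · rw [colSwap_mid_right (by omega) h7]
      rcases lt_trichotomy x i with h | rfl | h
      · rw [colSwap_of_row hS (x := x) (by omega), hv]
        rcases Nat.eq_or_lt_of_le (show x + 1 ≤ i by omega) with rfl | h'
        · rw [colSwap_row_right]
          rcases hhead with h8 | h8 <;> simp [h8, hasN]
        · rw [colSwap_of_row hS (by omega)]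
      · rw [hbelow le_rfl him, ← hv', hbl, colSwap_row_right]
        split_ifs <;> rfl
      rcases lt_trichotomy x m with h' | rfl | h'
      · rw [hbelow h.le h', colSwap_mid_right h h', hv']
      · rw [colSwap_foot_right h h2.le, colSwap_of_row hS (by omega), ← hv, (hfoot h2.le).1]
        rfl
      · rw [colSwap_of_row hS (by omega), colSwap_of_row hS (by omega), hv]
  · intro x y h1 h2 h3 h4
    rw [colSwap_n] at h2 h4
    have hh := hg.match_h x y h1 h2 h3 h4
    by_cases hy1 : y + 1 = j
    · rw [colSwap_of_col (y := y) (by omega) (by omega), hh]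
      subst hy1
      rw [hW x h1 h2]
    by_cases hy2 : y = j + 1
    · subst hy2
      rw [hE x h1 h2, colSwap_of_col (by omega) (by omega), hh]
    by_cases hy3 : y = j
    · subst hy3
      rcases lt_trichotomy x i with h | rfl | h
      · rw [colSwap_of_row hS (by omega), colSwap_of_row hS (by omega), hh]
      · rw [colSwap_row_left, colSwap_row_right]
        split_ifs <;> rfl
      rcases lt_trichotomy x m with h' | rfl | h'
      · rw [colSwap_mid_left h h', colSwap_mid_right h h']
        split_ifs with h5 <;> simp [h5, hasE]
      · rw [colSwap_foot_left h h2, colSwap_foot_right h h2]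
        split_ifs <;> rfl
      · rw [colSwap_of_row hS (by omega), colSwap_of_row hS (by omega), hh]
    · rw [colSwap_of_col hy3 hy2, colSwap_of_col (by omega) (by omega), hh]
  · intro y h1 h2
    rw [colSwap_n] at h2
    have ht := hg.top y h1 h2
    by_cases hy : y ≠ j ∧ y ≠ j + 1
    · rw [colSwap_of_col hy.1 hy.2, ht]
    rcases Nat.eq_or_lt_of_le hi with rfl | hi
    · rcases show y = j ∨ y = j + 1 by omega with rfl | rfl
      · rw [colSwap_row_left]
        rfl
      · rw [colSwap_row_right, ht]
        rfl
    · rw [colSwap_of_row hS (by omega), ht]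
  · intro y h1 h2
    rw [colSwap_n] at h2 ⊢
    have hb := hg.bot y h1 h2
    by_cases hy : y ≠ j ∧ y ≠ j + 1
    · rw [colSwap_of_col hy.1 hy.2, hb]
    have hmn : m ≠ g.n := by
      rintro rfl
      have := hg.bot (j + 1) (by omega) (by omega)
      rw [(hfoot le_rfl).1] at this
      simp [hasS] at this
    rcases Nat.lt_or_ge m g.n with h' | h'
    · rw [colSwap_of_row hS (by omega), hb]
    rcases show y = j ∨ y = j + 1 by omega with rfl | rfl
    · exact hmidS _ hin (by omega)
    · rw [colSwap_mid_right hin (by omega), hg.bot j hj hjn.le]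
  · intro x h1 h2
    rw [colSwap_n] at h2
    have hl := hg.left x h1 h2
    by_cases hj1 : 1 = j
    · subst hj1
      rw [hW x h1 h2, hl]
    · rw [colSwap_of_col (by omega) (by omega), hl]
  · intro x h1 h2
    rw [colSwap_n] at h2 ⊢
    have hr := hg.right x h1 h2
    by_cases hj1 : g.n = j + 1
    · rw [hj1, hE x h1 h2, ← hj1, hr]
    · rw [colSwap_of_col (by omega) (by omega), hr]

end ColumnSwap

section ColumnSwap

variable {g : Grid} {V H : ℕ → ℕ → ℕ} {i m j : ℕ} {σ : Perm'}

/-- The labels of south edges after `colSwap`, up to a relabeling `σ` of the pipes. -/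
def swapV (V : ℕ → ℕ → ℕ) (i m j : ℕ) (σ : Perm') (x y : ℕ) : ℕ :=
  if i ≤ x ∧ x < m ∧ y = j then σ (V x (j + 1))
  else if i ≤ x ∧ x < m ∧ y = j + 1 then σ (V x j)
  else σ (V x y)

/-- The labels of east edges after `colSwap`, up to a relabeling `σ` of the pipes. -/
def swapH (V H : ℕ → ℕ → ℕ) (i m j : ℕ) (σ : Perm') (x y : ℕ) : ℕ :=
  if x = i ∧ y = j then σ (V x (j + 1))
  else if i < x ∧ x < m ∧ y = j then σ (H x (j - 1))
  else σ (H x y)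

lemma swapV_left {x : ℕ} (h1 : i ≤ x) (h2 : x < m) :
    swapV V i m j σ x j = σ (V x (j + 1)) := by
  simp [swapV, h1, h2]

lemma swapV_right {x : ℕ} (h1 : i ≤ x) (h2 : x < m) :
    swapV V i m j σ x (j + 1) = σ (V x j) := by
  simp [swapV, h1, h2]

lemma swapV_other {x y : ℕ} (h : x < i ∨ m ≤ x ∨ (y ≠ j ∧ y ≠ j + 1)) :
    swapV V i m j σ x y = σ (V x y) := by
  rw [swapV, if_neg (by omega), if_neg (by omega)]

lemma swapH_row : swapH V H i m j σ i j = σ (V i (j + 1)) := by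
  simp [swapH]

lemma swapH_mid {x : ℕ} (h1 : i < x) (h2 : x < m) :
    swapH V H i m j σ x j = σ (H x (j - 1)) := by
  simp [swapH, h1, h2, h1.ne']

lemma swapH_other {x y : ℕ} (h : x < i ∨ (m ≤ x ∧ i < x) ∨ y ≠ j) :
    swapH V H i m j σ x y = σ (H x y) := by
  rw [swapH, if_neg (by omega), if_neg (by omega)]

/-- In the rows between `i` and `m`, the east edge of column `j + 1` carries the label of the
east edge of column `j`. -/
lemma IsSwappable.H_right (hS : IsSwappable g i m j) (hg : IsTiling g) (hL : IsLabeling g V H)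
    {x : ℕ} (h1 : i < x) (h2 : x < m) (hE : hasE (g.tile x j) = true) :
    g.tile x (j + 1) = .cross ∧ H x (j + 1) = H x j := by
  have := hS.m_le
  have hi := hS.one_le_i
  have hj := hS.j_lt
  have hc : g.tile x (j + 1) = .cross := by
    rw [hg.match_h x j (by omega) (by omega) hS.one_le_j hj] at hE
    rcases hS.through x h1 h2 with h | h
    · simp [h, hasW] at hE
    · exact h
  refine ⟨hc, ?_⟩
  have := hL.east x (j + 1) ⟨by omega, by omega, by omega, by omega⟩ (Or.inr hc)
  simpa using this

lemma IsSwappable.isLabeling (hS : IsSwappable g i m j) (hg : IsTiling g)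
    (hL : IsLabeling g V H) (hσ : (m ≤ g.n ∧ σ = 1) ∨ (m = g.n + 1 ∧ σ = sT j)) :
    IsLabeling (colSwap g i m j) (swapV V i m j σ) (swapH V H i m j σ) := by
  obtain ⟨hi, him, hin, hm, hj, hjn, hbl, hhead, hthru, hfoot⟩ := id hS
  have hfootV : m ≤ g.n → V (m - 1) (j + 1) = H m j := by
    intro h
    simpa using hL.nw m (j + 1) ⟨by omega, h, by omega, by omega⟩ (hfoot h).1
  refine ⟨?_, ?_, ?_, ?_, ?_⟩
  · intro y h1 h2
    rw [colSwap_n] at h2 ⊢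
    rcases hσ with ⟨hmn, rfl⟩ | ⟨rfl, rfl⟩
    · rw [swapV_other (by omega), hL.bottom y h1 h2]
      rfl
    · by_cases hyj : y = j
      · subst hyj
        rw [swapV_left (by omega) (by omega), hL.bottom _ (by omega) (by omega)]
        simp [sT]
      by_cases hyj' : y = j + 1
      · subst hyj'
        rw [swapV_right (by omega) (by omega), hL.bottom _ (by omega) (by omega)]
        simp [sT]
      · rw [swapV_other (by omega), hL.bottom y h1 h2, sT, Equiv.swap_apply_of_ne_of_ne hyj hyj']
  · intro x y hxy ht
    rw [colSwap_inGrid] at hxy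
    obtain ⟨h1, h2, h3, h4⟩ := id hxy
    by_cases hy : y ≠ j ∧ y ≠ j + 1
    · rw [colSwap_of_col hy.1 hy.2] at ht
      rw [swapV_other (by omega), swapV_other (by omega), hL.north x y hxy ht]
    rcases lt_trichotomy x i with h | h | h
    · rw [colSwap_of_row hS (by omega)] at ht
      rw [swapV_other (by omega), swapV_other (by omega), hL.north x y hxy ht]
    · subst h
      rcases show y = j ∨ y = j + 1 by omega with rfl | rfl
      · simp [colSwap_row_left] at ht
      · rw [colSwap_row_right] at ht
        split_ifs at ht <;> simp at ht
    rcases lt_trichotomy x m with h' | h' | h'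
    · rcases show y = j ∨ y = j + 1 by omega with rfl | rfl
      · rw [swapV_left (by omega) (by omega), swapV_left h.le h',
          hL.north x (y + 1) ⟨h1, h2, by omega, by omega⟩ (hthru x h h')]
      · rw [colSwap_mid_right h h'] at ht
        rw [swapV_right (by omega) (by omega), swapV_right h.le h',
          hL.north x j ⟨h1, h2, hj, hjn.le⟩ ht]
    · subst h'
      rcases show y = j ∨ y = j + 1 by omega with rfl | rfl
      · rw [swapV_left (by omega) (by omega), swapV_other (by omega), hfootV h2]
        rcases (hfoot h2).2 with h5 | h5
        · simp [colSwap_foot_left h h2, h5, hasS] at ht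
        · rw [hL.se x y hxy h5]
      · simp [colSwap_foot_right h h2] at ht
    · rw [colSwap_of_row hS (by omega)] at ht
      rw [swapV_other (by omega), swapV_other (by omega), hL.north x y hxy ht]
  · intro x y hxy ht
    rw [colSwap_inGrid] at hxy
    obtain ⟨h1, h2, h3, h4⟩ := id hxy
    by_cases hy : y ≠ j ∧ y ≠ j + 1
    · rw [colSwap_of_col hy.1 hy.2] at ht
      rw [swapH_other (by omega), swapH_other (by omega), hL.east x y hxy ht]
    rcases lt_trichotomy x i with h | h | h
    · rw [colSwap_of_row hS (by omega)] at ht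
      rw [swapH_other (by omega), swapH_other (by omega), hL.east x y hxy ht]
    · subst h
      rcases show y = j ∨ y = j + 1 by omega with rfl | rfl
      · simp [colSwap_row_left] at ht
      · rw [swapH_other (by omega), Nat.add_sub_cancel, swapH_row]
        rcases hhead with h5 | h5
        · rw [hL.se x _ hxy h5]
        · simp [colSwap_row_right, h5, hasN] at ht
    rcases lt_trichotomy x m with h' | h' | h'
    · rcases show y = j ∨ y = j + 1 by omega with rfl | rfl
      · rw [swapH_mid h h', swapH_other (by omega)]
      · rw [colSwap_mid_right h h'] at ht
        rw [swapH_other (by omega), Nat.add_sub_cancel, swapH_mid h h',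
          (hS.H_right hg hL h h' (by rcases ht with h5 | h5 <;> simp [h5, hasE])).2,
          hL.east x j ⟨h1, h2, hj, hjn.le⟩ ht]
    · subst h'
      rcases show y = j ∨ y = j + 1 by omega with rfl | rfl
      · rw [colSwap_foot_left h h2] at ht
        rcases (hfoot h2).2 with h5 | h5
        · simp [h5, hasS] at ht
        · rw [swapH_other (by omega), swapH_other (by omega)]
          simp [h5, hasS] at ht
      · simp [colSwap_foot_right h h2] at ht
    · rw [colSwap_of_row hS (by omega)] at ht
      rw [swapH_other (by omega), swapH_other (by omega), hL.east x y hxy ht]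
  · intro x y hxy ht
    rw [colSwap_inGrid] at hxy
    obtain ⟨h1, h2, h3, h4⟩ := id hxy
    by_cases hy : y ≠ j ∧ y ≠ j + 1
    · rw [colSwap_of_col hy.1 hy.2] at ht
      rw [swapH_other (by omega), swapV_other (by omega), hL.se x y hxy ht]
    rcases lt_trichotomy x i with h | h | h
    · rw [colSwap_of_row hS (by omega)] at ht
      rw [swapH_other (by omega), swapV_other (by omega), hL.se x y hxy ht]
    · subst h
      rcases show y = j ∨ y = j + 1 by omega with rfl | rfl
      · rw [swapH_row, swapV_left le_rfl him]
      · rw [colSwap_row_right] at ht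
        split_ifs at ht
    rcases lt_trichotomy x m with h' | h' | h'
    · rcases show y = j ∨ y = j + 1 by omega with rfl | rfl
      · rw [colSwap_mid_left h h'] at ht
        split_ifs at ht
      · rw [colSwap_mid_right h h'] at ht
        rw [swapH_other (by omega), swapV_right h.le h',
          (hS.H_right hg hL h h' (by simp [ht, hasE])).2, hL.se x j ⟨h1, h2, hj, hjn.le⟩ ht]
    · subst h'
      rcases show y = j ∨ y = j + 1 by omega with rfl | rfl
      · rw [colSwap_foot_left h h2] at ht
        split_ifs at ht
      · simp [colSwap_foot_right h h2] at ht
    · rw [colSwap_of_row hS (by omega)] at ht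
      rw [swapH_other (by omega), swapV_other (by omega), hL.se x y hxy ht]
  · intro x y hxy ht
    rw [colSwap_inGrid] at hxy
    obtain ⟨h1, h2, h3, h4⟩ := id hxy
    by_cases hy : y ≠ j ∧ y ≠ j + 1
    · rw [colSwap_of_col hy.1 hy.2] at ht
      rw [swapH_other (by omega), swapV_other (by omega), hL.nw x y hxy ht]
    rcases lt_trichotomy x i with h | h | h
    · rw [colSwap_of_row hS (by omega)] at ht
      rw [swapH_other (by omega), swapV_other (by omega), hL.nw x y hxy ht]
    · subst h
      rcases show y = j ∨ y = j + 1 by omega with rfl | rfl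
      · simp [colSwap_row_left] at ht
      · rw [swapV_other (by omega), Nat.add_sub_cancel, swapH_row]
        rcases hhead with h5 | h5
        · simp [colSwap_row_right, h5, hasN] at ht
        · rw [hL.north x _ hxy (Or.inl h5)]
    rcases lt_trichotomy x m with h' | h' | h'
    · rcases show y = j ∨ y = j + 1 by omega with rfl | rfl
      · rw [colSwap_mid_left h h'] at ht
        split_ifs at ht
      · rw [colSwap_mid_right h h'] at ht
        rw [Nat.add_sub_cancel, swapH_mid h h', swapV_right (by omega) (by omega),
          hL.nw x j ⟨h1, h2, hj, hjn.le⟩ ht]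
    · subst h'
      rcases show y = j ∨ y = j + 1 by omega with rfl | rfl
      · rw [swapV_left (by omega) (by omega), swapH_other (by omega), hfootV h2]
        rcases (hfoot h2).2 with h5 | h5
        · rw [hL.east x y hxy (Or.inl h5)]
        · simp [colSwap_foot_left h h2, h5, hasS] at ht
      · simp [colSwap_foot_right h h2] at ht
    · rw [colSwap_of_row hS (by omega)] at ht
      rw [swapH_other (by omega), swapV_other (by omega), hL.nw x y hxy ht]

/-- The crossing `(x, y)` of `colSwap g i m j` involves the same pipes as the crossing `(a, b)`
of `g`. -/
def CrossMatch (g : Grid) (i m j x y a b : ℕ) : Prop :=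
  (a = x ∧ b = y ∧ (x < i ∨ m < x ∨ (y ≠ j ∧ y ≠ j + 1))) ∨
  (i < x ∧ x < m ∧ y = j ∧ a = x ∧ b = j + 1 ∧ g.tile x j ≠ .se) ∨
  (i < x ∧ x < m ∧ y = j ∧ i < a ∧ a < x ∧ b = j + 1 ∧ g.tile a j = .se ∧ g.tile x j = .nw ∧
    ∀ t, a < t → t < x → g.tile t j = .vert ∨ g.tile t j = .cross) ∨
  (i < x ∧ x < m ∧ y = j + 1 ∧ a = x ∧ b = j)

lemma CrossMatch.unique {x y x' y' a b : ℕ} (h : CrossMatch g i m j x y a b)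
    (h' : CrossMatch g i m j x' y' a b) : x = x' ∧ y = y' := by
  rcases h with ⟨rfl, rfl, h⟩ | ⟨h1, h2, rfl, rfl, rfl, h⟩ |
      ⟨h1, h2, rfl, h3, h4, rfl, h5, h6, h7⟩ | ⟨h1, h2, rfl, rfl, rfl⟩ <;>
    rcases h' with ⟨h1', h2', h'⟩ | ⟨h1', h2', rfl, h3', h4', h'⟩ |
      ⟨h1', h2', rfl, h3', h4', h4'', h5', h6', h7'⟩ | ⟨h1', h2', rfl, rfl, h3'⟩
  all_goals try omega
  all_goals try subst h3'
  all_goals try contradiction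
  rcases lt_trichotomy x x' with hlt | rfl | hlt
  · rcases h7' x h4 hlt with h8 | h8 <;> simp [h8] at h6
  · simp
  · rcases h7 x' h4' hlt with h8 | h8 <;> simp [h8] at h6'

lemma IsSwappable.exists_crossMatch (hS : IsSwappable g i m j) (hg : IsTiling g)
    (hL : IsLabeling g V H) {x y : ℕ} (hxy : InGrid g x y)
    (ht : (colSwap g i m j).tile x y = .cross) :
    ∃ a b, CrossMatch g i m j x y a b ∧ InGrid g a b ∧ g.tile a b = .cross ∧
      swapV V i m j σ x y = σ (V a b) ∧ swapH V H i m j σ x (y - 1) = σ (H a (b - 1)) := by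
  obtain ⟨hi, him, hin, hm, hj, hjn, hbl, hhead, hthru, hfoot⟩ := id hS
  obtain ⟨h1, h2, h3, h4⟩ := id hxy
  by_cases hout : x < i ∨ m < x ∨ (y ≠ j ∧ y ≠ j + 1)
  · refine ⟨x, y, Or.inl ⟨rfl, rfl, hout⟩, hxy, ?_, swapV_other (by omega),
      swapH_other (by omega)⟩
    by_cases hy : y ≠ j ∧ y ≠ j + 1
    · rwa [colSwap_of_col hy.1 hy.2] at ht
    · rwa [colSwap_of_row hS (by omega)] at ht
  have hyj : y = j ∨ y = j + 1 := by omega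
  have hxi : i < x := by
    rcases Nat.eq_or_lt_of_le (show i ≤ x by omega) with rfl | h
    · exfalso
      rcases hyj with rfl | rfl
      · simp [colSwap_row_left] at ht
      · rw [colSwap_row_right] at ht
        split_ifs at ht
    · exact h
  have hxm : x < m := by
    rcases Nat.eq_or_lt_of_le (show x ≤ m by omega) with rfl | h
    · exfalso
      rcases hyj with rfl | rfl
      · rw [colSwap_foot_left hxi h2] at ht
        split_ifs at ht
      · simp [colSwap_foot_right hxi h2] at ht
    · exact h
  rcases hyj with rfl | rfl
  · rw [colSwap_mid_left hxi hxm] at ht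
    have hW : hasW (g.tile x y) = true := by
      by_contra h
      simp [h] at ht
    have hnb := hg.no_bump x y hxy
    have hthru' : hasE (g.tile x y) = true → g.tile x y = .horiz ∨ g.tile x y = .cross →
        ∃ a b, CrossMatch g i m y x y a b ∧ InGrid g a b ∧ g.tile a b = .cross ∧
          swapV V i m y σ x y = σ (V a b) ∧
          swapH V H i m y σ x (y - 1) = σ (H a (b - 1)) := by
      intro hE h5
      refine ⟨x, y + 1, Or.inr (Or.inl ⟨hxi, hxm, rfl, rfl, rfl, ?_⟩),
        ⟨h1, h2, by omega, by omega⟩, (hS.H_right hg hL hxi hxm hE).1,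
        swapV_left hxi.le hxm, ?_⟩
      · rcases h5 with h5 | h5 <;> simp [h5]
      · rw [swapH_other (by omega), Nat.add_sub_cancel, hL.east x y hxy h5]
    rcases h5 : g.tile x y with _ | _ | _ | _ | _ | _ | _ <;> simp [h5, hasW] at hW hnb
    · exact hthru' (by simp [h5, hasE]) (by simp [h5])
    · obtain ⟨k, hk1, hk2, hk3, hk4⟩ := hg.exists_se_above (x := x) (j := y) hi hxi h2 h3 h4
        (by simp [h5, hasN]) (by simp [hbl, hasS])
      have hkin : InGrid g k y := ⟨by omega, by omega, h3, h4⟩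
      refine ⟨k, y + 1, Or.inr (Or.inr (Or.inl ⟨hxi, hxm, rfl, hk1, hk2, rfl, hk3, h5, hk4⟩)),
        ⟨by omega, by omega, by omega, by omega⟩,
        (hS.H_right hg hL hk1 (by omega) (by simp [hk3, hasE])).1, ?_, ?_⟩
      · rw [swapV_left hxi.le hxm, hL.V_const hk2.le h2 (by omega) (by omega)
          (fun t ht1 ht2 => hthru t (by omega) (by omega))]
      · rw [swapH_other (by omega), Nat.add_sub_cancel, ← hL.nw x y hxy h5,
          hL.se k y hkin hk3, hL.V_const (a := k) (b := x - 1) (by omega) (by omega) h3 h4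
          (fun t ht1 ht2 => hk4 t ht1 (by omega))]
    · exact hthru' (by simp [h5, hasE]) (by simp [h5])
  · rw [colSwap_mid_right hxi hxm] at ht
    exact ⟨x, j, Or.inr (Or.inr (Or.inr ⟨hxi, hxm, rfl, rfl, rfl⟩)), ⟨h1, h2, hj, hjn.le⟩, ht,
      swapV_right hxi.le hxm, swapH_mid hxi hxm⟩

lemma IsSwappable.isReducedLabeling (hS : IsSwappable g i m j) (hg : IsTiling g)
    (hL : IsLabeling g V H) (hR : IsReducedLabeling g V H) :
    IsReducedLabeling (colSwap g i m j) (swapV V i m j σ) (swapH V H i m j σ) := by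
  intro x y x' y' hin hin' ht ht' hpair
  obtain ⟨a, b, hm, hab, hc, hV, hH⟩ := hS.exists_crossMatch (σ := σ) hg hL hin ht
  obtain ⟨a', b', hm', hab', hc', hV', hH'⟩ := hS.exists_crossMatch (σ := σ) hg hL hin' ht'
  rw [hV, hV', hH, hH'] at hpair
  simp only [EmbeddingLike.apply_eq_iff_eq] at hpair
  obtain ⟨rfl, rfl⟩ := hR a b a' b' hab hab' hc hc' hpair
  exact hm.unique hm'

lemma IsSwappable.memBPD {w : Perm'} (hS : IsSwappable g i m j) (hB : MemBPD w g)
    (hσ : (m ≤ g.n ∧ σ = 1) ∨ (m = g.n + 1 ∧ σ = sT j)) :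
    MemBPD (σ * w) (colSwap g i m j) := by
  obtain ⟨V, H, hL⟩ := exists_isLabeling g
  have hg := hB.1.isTiling
  have hj := hS.one_le_j
  have hjn := hS.j_lt
  have hfix : ∀ k, k = 0 ∨ g.n < k → σ k = k := by
    intro k hk
    rcases hσ with ⟨-, rfl⟩ | ⟨-, rfl⟩
    · rfl
    · rw [sT, Equiv.swap_apply_of_ne_of_ne (by omega) (by omega)]
  refine memBPD_of_labeling (hS.isTiling hg) (hS.isLabeling hg hL hσ)
    (hS.isReducedLabeling hg hL (hB.1.isReducedLabeling hL)) ?_ ?_ ?_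
  · rw [Equiv.Perm.mul_apply, hB.2.1, hfix 0 (Or.inl rfl)]
  · intro k hk
    rw [Equiv.Perm.mul_apply, hB.2.2.1 k hk, hfix k (Or.inr hk)]
  · intro r h1 h2
    rw [colSwap_n, swapH_other (by omega), hB.exit_label hL h1 h2, Equiv.Perm.mul_apply]

end ColumnSwap

/-! ### The elementary step of the Gao–Huang procedure -/

section Step

variable {g : Grid} {i m j : ℕ}

lemma find?_range'_one {n x : ℕ} {p : ℕ → Bool} :
    (List.range' 1 n).find? p = some x ↔
      p x = true ∧ 1 ≤ x ∧ x ≤ n ∧ ∀ t, 1 ≤ t → t < x → p t = false := by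
  rw [List.find?_range'_eq_some]
  simp only [List.mem_range'_1]
  constructor
  · rintro ⟨h1, h2, h3⟩
    exact ⟨h1, by omega, by omega, fun t ht ht' => by simpa using h3 t ht ht'⟩
  · rintro ⟨h1, h2, h3, h4⟩
    exact ⟨h1, by omega, fun t ht ht' => by simpa using h4 t ht ht'⟩

lemma find?_range'_one_isSome {n x : ℕ} {p : ℕ → Bool} (h1 : 1 ≤ x) (h2 : x ≤ n)
    (h : p x = true) : ∃ y, (List.range' 1 n).find? p = some y := by
  rw [← Option.isSome_iff_exists, List.find?_isSome]
  exact ⟨x, by rw [List.mem_range'_1]; omega, h⟩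

lemma mem_qPairs {k k' : ℕ} : (k, k') ∈ qPairs g i m j ↔
    (1 ≤ k ∧ i < k ∧ g.tile k j = .se) ∧ k < k' ∧ k' < m ∧ k' ≤ g.n ∧ g.tile k' j = .nw ∧
      ∀ t, k < t → t < k' → g.tile t j ≠ .nw := by
  have key : (k, k') ∈ qPairs g i m j ↔ (1 ≤ k ∧ k ≤ g.n) ∧ (i < k ∧ k < m ∧ g.tile k j = .se) ∧
      (List.range' 1 g.n).find?
        (fun k' => decide (k < k' ∧ k' < m ∧ g.tile k' j = Tile.nw)) = some k' := by
    unfold qPairs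
    rw [List.mem_filterMap]
    constructor
    · rintro ⟨a, ha, h⟩
      split_ifs at h with h0
      split at h
      · rename_i b hb
        simp only [Option.some.injEq, Prod.mk.injEq] at h
        obtain ⟨rfl, rfl⟩ := h
        rw [List.mem_range'_1] at ha
        exact ⟨by omega, h0, hb⟩
      · simp at h
    · rintro ⟨h1, h2, h3⟩
      refine ⟨k, by rw [List.mem_range'_1]; omega, ?_⟩
      rw [if_pos h2, h3]
  rw [key, find?_range'_one]
  simp only [decide_eq_true_eq, decide_eq_false_iff_not]
  constructor
  · rintro ⟨h1, h2, h3, h4, h5, h6⟩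
    exact ⟨⟨h1.1, h2.1, h2.2.2⟩, h3.1, h3.2.1, h5, h3.2.2,
      fun t ht ht' h => h6 t (by omega) ht' ⟨ht, by omega, h⟩⟩
  · rintro ⟨h1, h2, h3, h4, h5, h6⟩
    exact ⟨⟨h1.1, by omega⟩, ⟨h1.2.1, by omega, h1.2.2⟩, ⟨h2, h3, h5⟩, by omega, h4,
      fun t ht ht' h => h6 t h.1 ht' h.2.2⟩

lemma IsTiling.through_of_mem_qPairs (hg : IsTiling g) (hm : m ≤ g.n)
    (hj : 1 ≤ j) (hjn : j ≤ g.n) (hN : hasN (g.tile m j) = false) {k k' : ℕ}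
    (h : (k, k') ∈ qPairs g i m j) {t : ℕ} (h1 : k < t) (h2 : t < k') :
    g.tile t j = .vert ∨ g.tile t j = .cross := by
  rw [mem_qPairs] at h
  obtain ⟨⟨hk, hik, hse⟩, hkk, hkm, hkn, hnw, hmin⟩ := h
  obtain ⟨l, hl1, hl2, hl3, hl4⟩ := hg.exists_nw_below (x := k) (m := m) hk (by omega) hm hj hjn
    (by simp [hse, hasS]) hN
  refine hl4 t h1 ?_
  by_contra hlt
  exact hmin l hl1 (by omega) hl3

lemma IsTiling.exists_mem_qPairs (hg : IsTiling g) (hm : m ≤ g.n)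
    (hj : 1 ≤ j) (hjn : j ≤ g.n) (hN : hasN (g.tile m j) = false) {k : ℕ} (hk : 1 ≤ k)
    (hik : i < k) (hkm : k < m) (hse : g.tile k j = .se) : ∃ k', (k, k') ∈ qPairs g i m j := by
  obtain ⟨l, hl1, hl2, hl3, hl4⟩ := hg.exists_nw_below (x := k) (m := m) hk hkm hm hj hjn
    (by simp [hse, hasS]) hN
  refine ⟨l, mem_qPairs.2 ⟨⟨hk, hik, hse⟩, hl1, hl2, by omega, hl3, fun t h1 h2 h => ?_⟩⟩
  rcases hl4 t h1 h2 with h' | h' <;> simp [h'] at h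

lemma IsTiling.exists_mem_qPairs_of_hasN (hg : IsTiling g) (hi : 1 ≤ i) (hm : m ≤ g.n)
    (hj : 1 ≤ j) (hjn : j ≤ g.n) (hN : hasN (g.tile m j) = false)
    (hS : hasS (g.tile i j) = false) {x : ℕ} (hix : i < x) (hxm : x < m)
    (hx : hasN (g.tile x j) = true) : ∃ k k', (k, k') ∈ qPairs g i m j ∧ k < x ∧ x ≤ k' := by
  obtain ⟨k, hk1, hk2, hk3, hk4⟩ := hg.exists_se_above hi hix (by omega) hj hjn hx hS
  obtain ⟨k', hk'⟩ := hg.exists_mem_qPairs hm hj hjn hN (by omega) hk1 (by omega) hk3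
  refine ⟨k, k', hk', hk2, ?_⟩
  by_contra hlt
  obtain ⟨-, hkk, -, -, hnw, -⟩ := mem_qPairs.1 hk'
  rcases hk4 k' (by omega) (by omega) with e | e <;> simp [e] at hnw

/-- Evaluation of a fold of cellwise operations at a cell where every operation fixes the value. -/
lemma foldl_cell_fixed {α : Type*} {F : (ℕ → ℕ → Tile) → α → ℕ → ℕ → Tile} {x y : ℕ} {t : Tile}
    {L : List α} (h : ∀ p ∈ L, ∀ T : ℕ → ℕ → Tile, T x y = t → F T p x y = t)
    {T : ℕ → ℕ → Tile} (hT : T x y = t) : L.foldl F T x y = t := by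
  induction L generalizing T with
  | nil => exact hT
  | cons a L ih =>
    exact ih (fun p hp => h p (List.mem_cons_of_mem _ hp)) (h a List.mem_cons_self T hT)

/-- Evaluation of a fold of cellwise operations at a cell changed by some operation. -/
lemma foldl_cell_changed {α : Type*} {F : (ℕ → ℕ → Tile) → α → ℕ → ℕ → Tile} {x y : ℕ}
    {t t' : Tile} {L : List α}
    (h : ∀ p ∈ L, ∀ T : ℕ → ℕ → Tile, T x y = t → F T p x y = t ∨ F T p x y = t')
    (h' : ∀ p ∈ L, ∀ T : ℕ → ℕ → Tile, T x y = t' → F T p x y = t') {p : α} (hp : p ∈ L)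
    (hpt : ∀ T : ℕ → ℕ → Tile, T x y = t → F T p x y = t')
    {T : ℕ → ℕ → Tile} (hT : T x y = t) : L.foldl F T x y = t' := by
  induction L generalizing T with
  | nil => simp at hp
  | cons a L ih =>
    have hL' := fun p hp => h' p (List.mem_cons_of_mem a hp)
    rw [List.foldl_cons]
    rcases List.mem_cons.1 hp with rfl | hp
    · exact foldl_cell_fixed hL' (hpt T hT)
    · rcases h a List.mem_cons_self T hT with e | e
      · exact ih (fun p hp => h p (List.mem_cons_of_mem _ hp)) hL' hp e
      · exact foldl_cell_fixed hL' e

lemma nablaIter_of_row {x y : ℕ} (h : ¬ (i < x ∧ x < m) ∨ (y ≠ j ∧ y ≠ j + 1)) :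
    (nablaIter g i m j).tile x y = nablaUndroop g.tile i m j x y := by
  refine foldl_cell_fixed (fun p hp T hT => ?_) rfl
  obtain ⟨k, k'⟩ := p
  have hp' := mem_qPairs.1 hp
  rw [← hT]
  simp only [nablaQDroop]
  rw [if_neg, if_neg, if_neg, if_neg, if_neg] <;> omega

lemma IsTiling.mem_qPairs_cases (hg : IsTiling g) (hm : m ≤ g.n) (hj : 1 ≤ j) (hjn : j ≤ g.n)
    (hN : hasN (g.tile m j) = false) {k k' : ℕ} (h : (k, k') ∈ qPairs g i m j) (x : ℕ) :
    (x < k ∨ k' < x) ∨ (x = k ∧ x < k' ∧ g.tile x j = .se) ∨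
    (k < x ∧ x = k' ∧ g.tile x j = .nw) ∨
    (k < x ∧ x < k' ∧ (g.tile x j = .vert ∨ g.tile x j = .cross)) := by
  have h' := mem_qPairs.1 h
  have h'' := hg.through_of_mem_qPairs hm hj hjn hN h (t := x)
  rcases lt_trichotomy x k with h1 | rfl | h1
  · exact Or.inl (Or.inl h1)
  · exact Or.inr (Or.inl ⟨rfl, h'.2.1, h'.1.2.2⟩)
  · rcases lt_trichotomy x k' with h2 | rfl | h2
    · exact Or.inr (Or.inr (Or.inr ⟨h1, h2, h'' h1 h2⟩))
    · exact Or.inr (Or.inr (Or.inl ⟨h1, rfl, h'.2.2.2.2.1⟩))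
    · exact Or.inl (Or.inr h2)

lemma nablaQDroop_outside {T : ℕ → ℕ → Tile} {k k' x y : ℕ} (hk : k < k') (h : x < k ∨ k' < x) :
    nablaQDroop T k k' j x y = T x y := by
  simp only [nablaQDroop]
  rw [if_neg, if_neg, if_neg, if_neg, if_neg] <;> omega

lemma nablaQDroop_top {T : ℕ → ℕ → Tile} {k k' x : ℕ} (hk : x = k) (h : x < k') :
    (T x j = .se → nablaQDroop T k k' j x j = .vert) ∧
    (T x j = .vert → nablaQDroop T k k' j x j = .vert) ∧
    (T x (j + 1) = .horiz → nablaQDroop T k k' j x (j + 1) = .se) ∧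
    (T x (j + 1) = .se → nablaQDroop T k k' j x (j + 1) = .se) := by
  subst hk
  refine ⟨fun hT => ?_, fun hT => ?_, fun hT => ?_, fun hT => ?_⟩ <;>
    simp [nablaQDroop, hT, h.ne]

lemma nablaQDroop_bot {T : ℕ → ℕ → Tile} {k k' x : ℕ} (hk : k < x) (h : x = k') :
    (T x j = .nw → nablaQDroop T k k' j x j = .cross) ∧
    (T x j = .cross → nablaQDroop T k k' j x j = .cross) ∧
    (T x (j + 1) = .blank → nablaQDroop T k k' j x (j + 1) = .nw) ∧
    (T x (j + 1) = .nw → nablaQDroop T k k' j x (j + 1) = .nw) := by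
  subst h
  refine ⟨fun hT => ?_, fun hT => ?_, fun hT => ?_, fun hT => ?_⟩ <;>
    simp [nablaQDroop, hT, hk.ne']

lemma nablaQDroop_between {T : ℕ → ℕ → Tile} {k k' x : ℕ} (hk : k < x) (h : x < k') :
    nablaQDroop T k k' j x j = T x j ∧
    (T x (j + 1) = .blank → nablaQDroop T k k' j x (j + 1) = .vert) ∧
    (T x (j + 1) = .vert → nablaQDroop T k k' j x (j + 1) = .vert) ∧
    (T x (j + 1) = .horiz → nablaQDroop T k k' j x (j + 1) = .cross) ∧
    (T x (j + 1) = .cross → nablaQDroop T k k' j x (j + 1) = .cross) := by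
  refine ⟨?_, fun hT => ?_, fun hT => ?_, fun hT => ?_, fun hT => ?_⟩ <;>
    simp [nablaQDroop, *, hk.ne', h.ne]

lemma IsTiling.nablaIter_mid (hg : IsTiling g) (hi : 1 ≤ i) (hm : m ≤ g.n) (hj : 1 ≤ j)
    (hjn : j < g.n) (hN : hasN (g.tile m j) = false) (hS : hasS (g.tile i j) = false) {x : ℕ}
    (h1 : i < x) (h2 : x < m) (hthru : g.tile x (j + 1) = .vert ∨ g.tile x (j + 1) = .cross) :
    (nablaIter g i m j).tile x j = (if hasW (g.tile x j) then .cross else .vert) ∧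
    (nablaIter g i m j).tile x (j + 1) = g.tile x j := by
  have hnb := hg.no_bump x j ⟨by omega, by omega, by omega, by omega⟩
  have hmh := hg.match_h x j (by omega) (by omega) hj hjn
  have hlt : ∀ p ∈ qPairs g i m j, p.1 < p.2 := fun p hp => (mem_qPairs.1 hp).2.1
  have hc : ∀ p ∈ qPairs g i m j, _ :=
    fun p hp => hg.mem_qPairs_cases hm hj hjn.le hN (i := i) hp x
  have hu1 : nablaUndroop g.tile i m j x j = (match g.tile x j with
      | Tile.blank => Tile.vert | Tile.horiz => Tile.cross | t => t) := by
    simp only [nablaUndroop, h1, h2, h1.ne', h2.ne, false_and, if_false, true_and, if_true]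
    cases g.tile x j <;> rfl
  have hu2 : nablaUndroop g.tile i m j x (j + 1) = (match g.tile x (j + 1) with
      | Tile.vert => Tile.blank | Tile.cross => Tile.horiz | t => t) := by
    simp [nablaUndroop, h1, h2, h1.ne', h2.ne]
    cases g.tile x (j + 1) <;> rfl
  have hpair : hasN (g.tile x j) = true → ∃ p ∈ qPairs g i m j, p.1 < x ∧ x ≤ p.2 := fun h => by
    obtain ⟨k, k', h⟩ := hg.exists_mem_qPairs_of_hasN hi hm hj hjn.le hN hS h1 h2 h
    exact ⟨(k, k'), h⟩
  have hpse : g.tile x j = .se → ∃ p ∈ qPairs g i m j, p.1 = x := fun h => by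
    obtain ⟨k', h⟩ := hg.exists_mem_qPairs hm hj hjn.le hN (by omega) h1 h2 h
    exact ⟨_, h, rfl⟩
  have houtside : ∀ p ∈ qPairs g i m j, ∀ (T : ℕ → ℕ → Tile) y, x < p.1 ∨ p.2 < x →
      nablaQDroop T p.1 p.2 j x y = T x y := fun p hp T y h => nablaQDroop_outside (hlt p hp) h
  unfold nablaIter
  dsimp only
  rcases ht : g.tile x j with _ | _ | _ | _ | _ | _ | _
  · have hr : g.tile x (j + 1) = .vert := by
      rcases hthru with h | h
      · exact h
      · simp [ht, h, hasE, hasW] at hmh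
    rw [ht] at hu1
    rw [hr] at hu2
    have ho : ∀ p ∈ qPairs g i m j, x < p.1 ∨ p.2 < x := fun p hp => by
      simpa [ht] using hc p hp
    exact ⟨foldl_cell_fixed (fun p hp T hT => by rw [houtside p hp _ _ (ho p hp), hT]) hu1,
      foldl_cell_fixed (fun p hp T hT => by rw [houtside p hp _ _ (ho p hp), hT]) hu2⟩
  · have hr : g.tile x (j + 1) = .vert := by
      rcases hthru with h | h
      · exact h
      · simp [ht, h, hasE, hasW] at hmh
    rw [ht] at hu1
    rw [hr] at hu2
    have ho : ∀ p ∈ qPairs g i m j, (x < p.1 ∨ p.2 < x) ∨ (p.1 < x ∧ x < p.2) := fun p hp => by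
      simpa [ht] using hc p hp
    obtain ⟨p, hp, hp1, hp2⟩ := hpair (by simp [ht, hasN])
    have hpb : p.1 < x ∧ x < p.2 := by have := ho p hp; omega
    refine ⟨foldl_cell_fixed (fun p hp T hT => ?_) hu1, foldl_cell_changed (fun p hp T hT => ?_)
      (fun p hp T hT => ?_) hp (fun T hT => (nablaQDroop_between hpb.1 hpb.2).2.1 hT) hu2⟩
    · rcases ho p hp with h | h
      · rw [houtside p hp _ _ h, hT]
      · rw [(nablaQDroop_between h.1 h.2).1, hT]
    · rcases ho p hp with h | h
      · exact Or.inl (by rw [houtside p hp _ _ h, hT])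
      · exact Or.inr ((nablaQDroop_between h.1 h.2).2.1 hT)
    · rcases ho p hp with h | h
      · rw [houtside p hp _ _ h, hT]
      · exact (nablaQDroop_between h.1 h.2).2.2.1 hT
  · have hr : g.tile x (j + 1) = .cross := by
      rcases hthru with h | h
      · simp [ht, h, hasE, hasW] at hmh
      · exact h
    rw [ht] at hu1
    rw [hr] at hu2
    have ho : ∀ p ∈ qPairs g i m j, x < p.1 ∨ p.2 < x := fun p hp => by
      simpa [ht] using hc p hp
    exact ⟨foldl_cell_fixed (fun p hp T hT => by rw [houtside p hp _ _ (ho p hp), hT]) hu1,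
      foldl_cell_fixed (fun p hp T hT => by rw [houtside p hp _ _ (ho p hp), hT]) hu2⟩
  · have hr : g.tile x (j + 1) = .cross := by
      rcases hthru with h | h
      · simp [ht, h, hasE, hasW] at hmh
      · exact h
    rw [ht] at hu1
    rw [hr] at hu2
    have ho : ∀ p ∈ qPairs g i m j, (x < p.1 ∨ p.2 < x) ∨ (x = p.1 ∧ x < p.2) := fun p hp => by
      simpa [ht] using hc p hp
    obtain ⟨p, hp, hp1⟩ := hpse ht
    have hpb : x = p.1 ∧ x < p.2 := by have := ho p hp; have := hlt p hp; omega
    refine ⟨foldl_cell_changed (fun p hp T hT => ?_)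
      (fun p hp T hT => ?_) hp (fun T hT => (nablaQDroop_top hpb.1 hpb.2).1 hT) hu1,
      foldl_cell_changed (fun p hp T hT => ?_)
      (fun p hp T hT => ?_) hp (fun T hT => (nablaQDroop_top hpb.1 hpb.2).2.2.1 hT) hu2⟩
    · rcases ho p hp with h | h
      · exact Or.inl (by rw [houtside p hp _ _ h, hT])
      · exact Or.inr ((nablaQDroop_top h.1 h.2).1 hT)
    · rcases ho p hp with h | h
      · rw [houtside p hp _ _ h, hT]
      · exact (nablaQDroop_top h.1 h.2).2.1 hT
    · rcases ho p hp with h | h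
      · exact Or.inl (by rw [houtside p hp _ _ h, hT])
      · exact Or.inr ((nablaQDroop_top h.1 h.2).2.2.1 hT)
    · rcases ho p hp with h | h
      · rw [houtside p hp _ _ h, hT]
      · exact (nablaQDroop_top h.1 h.2).2.2.2 hT
  · have hr : g.tile x (j + 1) = .vert := by
      rcases hthru with h | h
      · exact h
      · simp [ht, h, hasE, hasW] at hmh
    rw [ht] at hu1
    rw [hr] at hu2
    have ho : ∀ p ∈ qPairs g i m j, (x < p.1 ∨ p.2 < x) ∨ (p.1 < x ∧ x = p.2) := fun p hp => by
      simpa [ht] using hc p hp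
    obtain ⟨p, hp, hp1, hp2⟩ := hpair (by simp [ht, hasN])
    have hpb : p.1 < x ∧ x = p.2 := by have := ho p hp; omega
    refine ⟨foldl_cell_changed (fun p hp T hT => ?_)
      (fun p hp T hT => ?_) hp (fun T hT => (nablaQDroop_bot hpb.1 hpb.2).1 hT) hu1,
      foldl_cell_changed (fun p hp T hT => ?_)
      (fun p hp T hT => ?_) hp (fun T hT => (nablaQDroop_bot hpb.1 hpb.2).2.2.1 hT) hu2⟩
    · rcases ho p hp with h | h
      · exact Or.inl (by rw [houtside p hp _ _ h, hT])
      · exact Or.inr ((nablaQDroop_bot h.1 h.2).1 hT)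
    · rcases ho p hp with h | h
      · rw [houtside p hp _ _ h, hT]
      · exact (nablaQDroop_bot h.1 h.2).2.1 hT
    · rcases ho p hp with h | h
      · exact Or.inl (by rw [houtside p hp _ _ h, hT])
      · exact Or.inr ((nablaQDroop_bot h.1 h.2).2.2.1 hT)
    · rcases ho p hp with h | h
      · rw [houtside p hp _ _ h, hT]
      · exact (nablaQDroop_bot h.1 h.2).2.2.2 hT
  · have hr : g.tile x (j + 1) = .cross := by
      rcases hthru with h | h
      · simp [ht, h, hasE, hasW] at hmh
      · exact h
    rw [ht] at hu1
    rw [hr] at hu2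
    have ho : ∀ p ∈ qPairs g i m j, (x < p.1 ∨ p.2 < x) ∨ (p.1 < x ∧ x < p.2) := fun p hp => by
      simpa [ht] using hc p hp
    obtain ⟨p, hp, hp1, hp2⟩ := hpair (by simp [ht, hasN])
    have hpb : p.1 < x ∧ x < p.2 := by have := ho p hp; omega
    refine ⟨foldl_cell_fixed (fun p hp T hT => ?_) hu1, foldl_cell_changed (fun p hp T hT => ?_)
      (fun p hp T hT => ?_) hp (fun T hT => (nablaQDroop_between hpb.1 hpb.2).2.2.2.1 hT) hu2⟩
    · rcases ho p hp with h | h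
      · rw [houtside p hp _ _ h, hT]
      · rw [(nablaQDroop_between h.1 h.2).1, hT]
    · rcases ho p hp with h | h
      · exact Or.inl (by rw [houtside p hp _ _ h, hT])
      · exact Or.inr ((nablaQDroop_between h.1 h.2).2.2.2.1 hT)
    · rcases ho p hp with h | h
      · rw [houtside p hp _ _ h, hT]
      · exact (nablaQDroop_between h.1 h.2).2.2.2.2 hT
  · exact absurd ht hnb

lemma nablaIter_eq_of_tile {g' : Grid} (hn : g'.n = g.n)
    (h : ∀ x y, (nablaIter g i m j).tile x y = g'.tile x y) : nablaIter g i m j = g' := by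
  obtain ⟨n', t'⟩ := g'
  subst hn
  exact congrArg (Grid.mk g.n) (funext₂ h)

/-- A nonfinal step of the procedure is a `colSwap`. -/
lemma IsSwappable.nablaIter_eq (hS : IsSwappable g i m j) (hg : IsTiling g) (hm : m ≤ g.n) :
    nablaIter g i m j = colSwap g i m j := by
  have hi := hS.one_le_i
  have him := hS.i_lt
  have hfoot := hS.foot hm
  refine nablaIter_eq_of_tile rfl fun x y => ?_
  by_cases hy : y ≠ j ∧ y ≠ j + 1
  · rw [nablaIter_of_row (Or.inr hy), colSwap_of_col hy.1 hy.2]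
    simp [nablaUndroop, hy.1, hy.2]
  by_cases hx : i < x ∧ x < m
  · have key := hg.nablaIter_mid hi hm hS.one_le_j hS.j_lt
      (by rcases hfoot.2 with h | h <;> simp [h, hasN]) (by simp [hS.blank, hasS]) hx.1 hx.2
      (hS.through x hx.1 hx.2)
    obtain rfl | rfl : y = j ∨ y = j + 1 := by omega
    · rw [key.1, colSwap_mid_left hx.1 hx.2]
    · rw [key.2, colSwap_mid_right hx.1 hx.2]
  rw [nablaIter_of_row (Or.inl hx)]
  rcases eq_or_ne x i with rfl | hxi
  · obtain rfl | rfl : y = j ∨ y = j + 1 := by omega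
    · rw [colSwap_row_left]
      simp [nablaUndroop, hS.blank]
    · rw [colSwap_row_right]
      rcases hS.head with h | h <;> simp [nablaUndroop, h, hasN, him.ne]
  rcases eq_or_ne x m with rfl | hxm
  · obtain rfl | rfl : y = j ∨ y = j + 1 := by omega
    · rw [colSwap_foot_left him hm]
      rcases hfoot.2 with h | h <;> simp [nablaUndroop, h, hasS, him.ne']
    · rw [colSwap_foot_right him hm]
      simp [nablaUndroop, hfoot.1, him.ne']
  · rw [colSwap_of_row hS (by omega)]
    simp [nablaUndroop, hxi, hxm, hx]

/-- The final step of the procedure is a `colSwap` down to the bottom of the grid. -/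
lemma IsSwappable.nablaIter_eq_final (hS : IsSwappable g i (g.n + 1) j) (hg : IsTiling g)
    (him : i < m) (hm : m ≤ g.n) (hcross : g.tile m (j + 1) = .cross) (hse : g.tile m j = .se)
    (hthru : ∀ x, m < x → x ≤ g.n → g.tile x j = .vert ∨ g.tile x j = .cross) :
    nablaIter g i m j = colSwap g i (g.n + 1) j := by
  have hi := hS.one_le_i
  have hjn := hS.j_lt
  refine nablaIter_eq_of_tile rfl fun x y => ?_
  by_cases hy : y ≠ j ∧ y ≠ j + 1
  · rw [nablaIter_of_row (Or.inr hy), colSwap_of_col hy.1 hy.2]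
    simp [nablaUndroop, hy.1, hy.2]
  by_cases hx : i < x ∧ x < m
  · have key := hg.nablaIter_mid hi hm hS.one_le_j hS.j_lt
      (by simp [hse, hasN]) (by simp [hS.blank, hasS]) hx.1 hx.2
      (hS.through x hx.1 (by omega))
    obtain rfl | rfl : y = j ∨ y = j + 1 := by omega
    · rw [key.1, colSwap_mid_left hx.1 (by omega)]
    · rw [key.2, colSwap_mid_right hx.1 (by omega)]
  rw [nablaIter_of_row (Or.inl hx)]
  rcases eq_or_ne x i with rfl | hxi
  · obtain rfl | rfl : y = j ∨ y = j + 1 := by omega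
    · rw [colSwap_row_left]
      simp [nablaUndroop, hS.blank]
    · rw [colSwap_row_right]
      rcases hS.head with h | h <;> simp [nablaUndroop, h, hasN, him.ne]
  rcases eq_or_ne x m with rfl | hxm
  · obtain rfl | rfl : y = j ∨ y = j + 1 := by omega
    · rw [colSwap_mid_left him (by omega)]
      simp [nablaUndroop, hse, hasW, him.ne']
    · rw [colSwap_mid_right him (by omega)]
      simp [nablaUndroop, hcross, hse, him.ne']
  have hu : nablaUndroop g.tile i m j x y = g.tile x y := by
    simp [nablaUndroop, hxi, hxm, hx]
  rw [hu]
  by_cases hxn : m < x ∧ x ≤ g.n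
  · have ht := hthru x hxn.1 hxn.2
    have ht' := hS.through x (by omega) (by omega)
    have hmh := hg.match_h x j (by omega) hxn.2 hS.one_le_j hjn
    obtain rfl | rfl : y = j ∨ y = j + 1 := by omega
    · rw [colSwap_mid_left (by omega) (by omega)]
      rcases ht with h | h <;> simp [h, hasW]
    · rw [colSwap_mid_right (by omega) (by omega)]
      rcases ht with h | h <;> rcases ht' with h' | h' <;> simp_all [hasE, hasW]
  · rw [colSwap_of_row hS (by omega)]

end Step

section Descent

variable {g : Grid} {V H : ℕ → ℕ → ℕ} {i j : ℕ}

/-! ### Following pipes down a column -/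

/-- The pipe entering at the bottom of a column goes straight up that column until it first
turns. -/
lemma IsLabeling.through_of_V_eq (hL : IsLabeling g V H) (hg : IsTiling g) {x y : ℕ}
    (hin : InGrid g x y) (hS : hasS (g.tile x y) = true) (hV : V x y = y) {t : ℕ} (hxt : x < t)
    (ht : t ≤ g.n) : g.tile t y = .vert ∨ g.tile t y = .cross := by
  obtain ⟨h1, h2, h3, h4⟩ := id hin
  suffices key : ∀ d, x + d ≤ g.n → V (x + d) y = y ∧ hasS (g.tile (x + d) y) = true ∧
      (0 < d → g.tile (x + d) y = .vert ∨ g.tile (x + d) y = .cross) by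
    have := (key (t - x) (by omega)).2.2 (by omega)
    rwa [show x + (t - x) = t by omega] at this
  intro d
  induction d with
  | zero => exact fun _ => ⟨hV, hS, fun h => absurd h (lt_irrefl _)⟩
  | succ d ih =>
    intro hd
    obtain ⟨ih1, ih2, -⟩ := ih (by omega)
    have hin' : InGrid g (x + (d + 1)) y := ⟨by omega, hd, h3, h4⟩
    have hnb := hg.no_bump _ _ hin'
    rw [hg.match_v _ y (by omega) (by omega) h3 h4, add_assoc] at ih2
    have hn := hL.north _ _ hin'
    rw [show x + (d + 1) - 1 = x + d by omega] at hn
    rcases htl : g.tile (x + (d + 1)) y with _ | _ | _ | _ | _ | _ | _ <;>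
      simp [htl, hasN] at ih2 hnb
    · exact ⟨by rw [← hn (Or.inl htl), ih1], rfl, by simp⟩
    · obtain ⟨hy, hin'', hE⟩ := hg.of_hasW hin' (by simp [htl, hasW])
      have hb := hL.H_bounds hg hin'' hE
      have := hL.nw _ _ hin' htl
      rw [show x + (d + 1) - 1 = x + d by omega] at this
      omega
    · exact ⟨by rw [← hn (Or.inr htl), ih1], rfl, by simp⟩

/-- A pipe in a column other than its own entered that column at a `nw` elbow. -/
lemma IsLabeling.exists_nw_of_V_ne (hL : IsLabeling g V H) (hg : IsTiling g) {x y : ℕ}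
    (hin : InGrid g x y) (hS : hasS (g.tile x y) = true) (hV : V x y ≠ y) :
    ∃ k, x < k ∧ k ≤ g.n ∧ g.tile k y = .nw ∧ H k (y - 1) = V x y ∧
      ∀ t, x < t → t < k → (g.tile t y = .vert ∨ g.tile t y = .cross) ∧ V t y = V x y := by
  obtain ⟨h1, h2, h3, h4⟩ := id hin
  induction hd : g.n - x generalizing x with
  | zero =>
    obtain rfl : x = g.n := by omega
    exact absurd (hL.bottom y h3 h4) hV
  | succ d ih =>
    have hin' : InGrid g (x + 1) y := ⟨by omega, by omega, h3, h4⟩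
    have hnb := hg.no_bump _ _ hin'
    rw [hg.match_v _ y (by omega) (by omega) h3 h4] at hS
    by_cases hnw : g.tile (x + 1) y = .nw
    · exact ⟨x + 1, by omega, by omega, hnw, (hL.nw _ _ hin' hnw).symm, fun t _ _ => by omega⟩
    · have hthru : g.tile (x + 1) y = .vert ∨ g.tile (x + 1) y = .cross := by
        rcases htl : g.tile (x + 1) y with _ | _ | _ | _ | _ | _ | _ <;> simp_all [hasN]
      have hVx : V x y = V (x + 1) y := hL.north _ _ hin' hthru
      obtain ⟨k, hk1, hk2, hk3, hk4, hk5⟩ := ih hin'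
        (by rcases hthru with h | h <;> simp [h, hasS]) (by rwa [← hVx]) (by omega) (by omega)
        (by omega)
      refine ⟨k, by omega, hk2, hk3, by rw [hk4, hVx], fun t ht1 ht2 => ?_⟩
      rcases Nat.eq_or_lt_of_le (show x + 1 ≤ t by omega) with rfl | ht
      · exact ⟨hthru, hVx.symm⟩
      · rw [hVx]
        exact hk5 t ht ht2

/-- The row in which a pipe leaving column `y + 1` to the east has entered this column. -/
lemma IsLabeling.exists_enter (hL : IsLabeling g V H) (hg : IsTiling g) {x y : ℕ}
    (hin : InGrid g x (y + 1)) (hE : hasE (g.tile x (y + 1)) = true) (hH : H x (y + 1) ≤ y) :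
    ∃ k, x ≤ k ∧ k ≤ g.n ∧ 1 ≤ y ∧ hasE (g.tile k y) = true ∧ H k y = H x (y + 1) ∧
      (x < k → g.tile k (y + 1) = .nw) ∧ ∀ t, x < t → t < k →
        (g.tile t (y + 1) = .vert ∨ g.tile t (y + 1) = .cross) ∧ V t (y + 1) = H x (y + 1) := by
  have hnb := hg.no_bump _ _ hin
  obtain ⟨h1, h2, h3, h4⟩ := id hin
  by_cases hW : hasW (g.tile x (y + 1)) = true
  · have ht : g.tile x (y + 1) = .horiz ∨ g.tile x (y + 1) = .cross := by
      rcases htl : g.tile x (y + 1) with _ | _ | _ | _ | _ | _ | _ <;> simp_all [hasE, hasW]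
    obtain ⟨hy, -, hE'⟩ := hg.of_hasW hin hW
    exact ⟨x, le_rfl, h2, by omega, hE', (hL.east _ _ hin ht).symm, fun h => by omega,
      fun t _ _ => by omega⟩
  · have ht : g.tile x (y + 1) = .se := by
      rcases htl : g.tile x (y + 1) with _ | _ | _ | _ | _ | _ | _ <;> simp_all [hasE, hasW]
    have hHV := hL.se _ _ hin ht
    obtain ⟨k, hk1, hk2, hk3, hk4, hk5⟩ := hL.exists_nw_of_V_ne hg hin (by simp [ht, hasS])
      (by omega)
    obtain ⟨hy, -, hE'⟩ := hg.of_hasW (x := k) (y := y + 1) ⟨by omega, hk2, h3, h4⟩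
      (by simp [hk3, hasW])
    exact ⟨k, by omega, hk2, by omega, hE', by rw [hHV, ← hk4]; rfl, fun _ => hk3,
      fun t ht1 ht2 => by rw [hHV]; exact hk5 t ht1 ht2⟩

/-- The pipe `y` leaves column `y` at a `se` elbow. -/
lemma IsLabeling.se_of_H_eq (hL : IsLabeling g V H) (hg : IsTiling g) {x y : ℕ}
    (hin : InGrid g x y) (hE : hasE (g.tile x y) = true) (hH : H x y = y) :
    g.tile x y = .se ∧ V x y = y := by
  have hnb := hg.no_bump _ _ hin
  by_cases hW : hasW (g.tile x y) = true
  · have ht : g.tile x y = .horiz ∨ g.tile x y = .cross := by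
      rcases htl : g.tile x y with _ | _ | _ | _ | _ | _ | _ <;> simp_all [hasE, hasW]
    obtain ⟨hy, hin', hE'⟩ := hg.of_hasW hin hW
    have h1 := hL.east _ _ hin ht
    have h2 := hL.H_bounds hg hin' hE'
    omega
  · have ht : g.tile x y = .se := by
      rcases htl : g.tile x y with _ | _ | _ | _ | _ | _ | _ <;> simp_all [hasE, hasW]
    exact ⟨ht, by rw [← hL.se _ _ hin ht, hH]⟩

lemma IsLabeling.row_unique_of_H_eq (hL : IsLabeling g V H) (hg : IsTiling g) {x x' y : ℕ}
    (hin : InGrid g x y) (hE : hasE (g.tile x y) = true) (hH : H x y = y)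
    (hin' : InGrid g x' y) (hE' : hasE (g.tile x' y) = true) (hH' : H x' y = y) : x = x' := by
  obtain ⟨h1, h2⟩ := hL.se_of_H_eq hg hin hE hH
  obtain ⟨h1', h2'⟩ := hL.se_of_H_eq hg hin' hE' hH'
  rcases lt_trichotomy x x' with h | h | h
  · have := hL.through_of_V_eq hg hin (by simp [h1, hasS]) h2 h hin'.2.1
    simp [h1'] at this
  · exact h
  · have := hL.through_of_V_eq hg hin' (by simp [h1', hasS]) h2' h hin.2.1
    simp [h1] at this

/-- Two pipes which cross in column `j + 1` do not change their relative position later. -/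
lemma IsLabeling.lt_of_cross (hL : IsLabeling g V H) (hg : IsTiling g)
    (hR : IsReducedLabeling g V H) {x₀ : ℕ} (hx₀ : InGrid g x₀ (j + 1))
    (hc : g.tile x₀ (j + 1) = .cross) (hV : V x₀ (j + 1) = j + 1) (hH : H x₀ j = j) :
    ∀ y, j + 1 ≤ y → ∀ x x', InGrid g x y → InGrid g x' y → hasE (g.tile x y) = true →
      hasE (g.tile x' y) = true → H x y = j + 1 → H x' y = j → x < x' := by
  intro y hy
  induction y, hy using Nat.le_induction with
  | base =>
    intro x x' hx hx' hE hE' hHx hHx'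
    obtain ⟨hse, hVx⟩ := hL.se_of_H_eq hg hx hE hHx
    obtain ⟨h1, h2, h3, h4⟩ := id hx
    have hlt : x < x₀ := by
      rcases lt_trichotomy x x₀ with h | rfl | h
      · exact h
      · simp [hse] at hc
      · have := hL.through_of_V_eq hg hx₀ (by simp [hc, hasS]) hV h h2
        simp [hse] at this
    obtain ⟨k, hk1, hk2, hk3, hk4, hk5, hk6, -⟩ := hL.exists_enter hg hx' hE' (by omega)
    have hE₀ := (hg.of_hasW hx₀ (by simp [hc, hasW])).2.2
    have := hL.row_unique_of_H_eq hg (x := k) (x' := x₀) ⟨by have := hx'.1; omega, hk2, hk3, by omega⟩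
      hk4 (by rw [hk5, hHx']) ⟨hx₀.1, hx₀.2.1, hk3, by omega⟩ hE₀ hH
    subst this
    rcases Nat.eq_or_lt_of_le hk1 with rfl | h
    · exact hlt
    · simp [hk6 h] at hc
  | succ y hy ih =>
    intro x x' hx hx' hE hE' hHx hHx'
    obtain ⟨k, hk1, hk2, hk3, hk4, hk5, hk6, hk7⟩ := hL.exists_enter hg hx hE (by omega)
    obtain ⟨l, hl1, hl2, hl3, hl4, hl5, hl6, hl7⟩ := hL.exists_enter hg hx' hE' (by omega)
    obtain ⟨h1, h2, h3, h4⟩ := id hx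
    have hkl := ih k l ⟨by omega, hk2, hk3, by omega⟩ ⟨by have := hx'.1; omega, hl2, hl3, by omega⟩
      hk4 hl4 (by rw [hk5, hHx]) (by rw [hl5, hHx'])
    by_contra hlt
    have hne : x ≠ x' := by
      rintro rfl
      omega
    obtain ⟨hthru, hVk⟩ := hl7 k (by omega) hkl
    rw [hg.match_h k y (by omega) hk2 hk3 (by omega)] at hk4
    have hcr : g.tile k (y + 1) = .cross := by
      rcases hthru with h | h
      · simp [h, hasW] at hk4
      · exact h
    have := (hR _ _ _ _ ⟨by omega, hk2, h3, h4⟩ hx₀ hcr hc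
      (Or.inr ⟨by simp [hVk, hHx', hH], by simp [hk5, hHx, hV]⟩)).2
    omega

lemma MemBPD.symm_lt_of_cross {w : Perm'} (hB : MemBPD w g) (hL : IsLabeling g V H) {x₀ : ℕ}
    (hj : 1 ≤ j) (hx₀ : InGrid g x₀ (j + 1)) (hc : g.tile x₀ (j + 1) = .cross)
    (hV : V x₀ (j + 1) = j + 1) (hH : H x₀ j = j) : w.symm (j + 1) < w.symm j := by
  have hg := hB.1.isTiling
  have hjn := hx₀.2.2.2
  have hbd : ∀ c, 1 ≤ c → c ≤ g.n → 1 ≤ w.symm c ∧ w.symm c ≤ g.n := by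
    intro c h1 h2
    obtain ⟨r, he, hr1, hr2, -⟩ := exitRow_spec hL hg h1 h2
    rw [hB.2.2.2 c h1 h2] at he
    obtain rfl := Option.some.inj he
    exact ⟨hr1, hr2⟩
  obtain ⟨ha1, ha2⟩ := hbd (j + 1) (by omega) hjn
  obtain ⟨hb1, hb2⟩ := hbd j hj (by omega)
  refine hL.lt_of_cross hg (hB.1.isReducedLabeling hL) hx₀ hc hV hH g.n hjn _ _
    ⟨ha1, ha2, hg.pos, le_rfl⟩ ⟨hb1, hb2, hg.pos, le_rfl⟩ (hg.right _ ha1 ha2)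
    (hg.right _ hb1 hb2) ?_ ?_
  · rw [hB.exit_label hL ha1 ha2, Equiv.apply_symm_apply]
  · rw [hB.exit_label hL hb1 hb2, Equiv.apply_symm_apply]

end Descent

section Loop

variable {g : Grid} {V H : ℕ → ℕ → ℕ} {i j : ℕ}

/-! ### The marked-tile loop -/

lemma getLastD_takeWhile_range' {p : ℕ → Bool} {n s d : ℕ} (hs : p s = true)
    (hex : ∃ t, s ≤ t ∧ t < s + n ∧ p t = false) :
    s ≤ ((List.range' s n).takeWhile p).getLastD d ∧
    p (((List.range' s n).takeWhile p).getLastD d) = true ∧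
    p (((List.range' s n).takeWhile p).getLastD d + 1) = false := by
  induction n generalizing s d with
  | zero =>
    obtain ⟨t, h1, h2, -⟩ := hex
    omega
  | succ n ih =>
    obtain ⟨t, h1, h2, h3⟩ := hex
    have hst : s ≠ t := by
      rintro rfl
      simp [hs] at h3
    rw [List.range'_succ, List.takeWhile_cons_of_pos hs, List.getLastD_cons]
    rcases hp : p (s + 1) with _ | _
    · have : (List.range' (s + 1) n).takeWhile p = [] := by
        cases n with
        | zero => rfl
        | succ n => rw [List.range'_succ, List.takeWhile_cons_of_neg (by simp [hp])]
      rw [this]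
      exact ⟨le_rfl, hs, hp⟩
    · obtain ⟨e1, e2, e3⟩ := ih (d := s) hp ⟨t, by omega, by omega, h3⟩
      exact ⟨by omega, e2, e3⟩

lemma IsTiling.slideEast_spec (hg : IsTiling g) (hin : InGrid g i j) (hbl : g.tile i j = .blank) :
    j ≤ slideEast g i j ∧ slideEast g i j < g.n ∧ g.tile i (slideEast g i j) = .blank ∧
      g.tile i (slideEast g i j + 1) ≠ .blank := by
  obtain ⟨h1, h2, h3, h4⟩ := hin
  obtain ⟨e1, e2, e3⟩ := getLastD_takeWhile_range' (p := fun y => g.tile i y == Tile.blank)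
    (n := g.n + 1) (d := j) (s := j) (by simp [hbl]) ⟨g.n + 1, by omega, by omega, by
      rw [hg.outside i (g.n + 1) (by unfold InGrid; omega)]
      rfl⟩
  change j ≤ slideEast g i j at e1
  change (g.tile i (slideEast g i j) == Tile.blank) = true at e2
  change (g.tile i (slideEast g i j + 1) == Tile.blank) = false at e3
  rw [beq_iff_eq] at e2
  refine ⟨e1, ?_, e2, by simpa using e3⟩
  by_contra hlt
  rcases Nat.eq_or_lt_of_le (not_lt.1 hlt) with h | h
  · have := hg.right i h1 h2
    rw [h, e2] at this
    simp [hasE] at this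
  · have := hg.outside i (slideEast g i j) (by unfold InGrid; omega)
    rw [e2] at this
    simp at this

lemma IsTiling.head_of_blank (hg : IsTiling g) (hi : 1 ≤ i) (hin : i ≤ g.n) (hj : 1 ≤ j)
    (hjn : j < g.n) (hbl : g.tile i j = .blank) (hnb : g.tile i (j + 1) ≠ .blank) :
    g.tile i (j + 1) = .se ∨ g.tile i (j + 1) = .vert := by
  have hb := hg.no_bump i (j + 1) ⟨hi, hin, by omega, by omega⟩
  have hm := hg.match_h i j hi hin hj hjn
  rw [hbl] at hm
  rcases ht : g.tile i (j + 1) with _ | _ | _ | _ | _ | _ | _ <;> simp_all [hasE, hasW]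

/-- In a nonfinal step, the rectangle below the marked tile is swappable. -/
lemma IsLabeling.isSwappable_of_nw (hL : IsLabeling g V H) (hg : IsTiling g)
    (hR : IsReducedLabeling g V H) {m : ℕ} (hi : 1 ≤ i) (him : i < m) (hm : m ≤ g.n) (hj : 1 ≤ j)
    (hjn : j < g.n) (hbl : g.tile i j = .blank)
    (hhead : g.tile i (j + 1) = .se ∨ g.tile i (j + 1) = .vert) (hnw : g.tile m (j + 1) = .nw)
    (hH : H m j = V i (j + 1))
    (hthru : ∀ t, i < t → t < m →
      (g.tile t (j + 1) = .vert ∨ g.tile t (j + 1) = .cross) ∧ V t (j + 1) = V i (j + 1)) :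
    IsSwappable g i m j := by
  refine ⟨hi, him, by omega, by omega, hj, hjn, hbl, hhead, fun x h1 h2 => (hthru x h1 h2).1,
    fun _ => ⟨hnw, ?_⟩⟩
  have hin : InGrid g m j := ⟨by omega, hm, hj, by omega⟩
  have hb := hg.no_bump m j hin
  have hmh := hg.match_h m j (by omega) hm hj hjn
  rw [hnw] at hmh
  have hcr : g.tile m j ≠ .cross := by
    intro hcr
    obtain ⟨k, hk1, hk2, hk3, hk4⟩ := hg.exists_se_above hi him hm hj hjn.le
      (by simp [hcr, hasN]) (by simp [hbl, hasS])
    have hVk : V k j = V m j := hL.V_const hk2.le hm hj hjn.le fun t h1 h2 => by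
      rcases Nat.eq_or_lt_of_le h2 with rfl | h2
      · exact Or.inr hcr
      · exact hk4 t h1 h2
    have hHk := hL.se k j ⟨by omega, by omega, hj, hjn.le⟩ hk3
    have hHm := hL.east m j hin (Or.inr hcr)
    have hmk := hg.match_h k j (by omega) (by omega) hj hjn
    obtain ⟨hth, hVk'⟩ := hthru k hk1 hk2
    have hck : g.tile k (j + 1) = .cross := by
      rcases hth with h | h
      · simp [h, hk3, hasE, hasW] at hmk
      · exact h
    have := (hR k (j + 1) m j ⟨by omega, by omega, by omega, by omega⟩ hin hck hcr
      (Or.inr ⟨by rw [hVk', ← hHm, hH], by simpa [hHk] using hVk⟩)).2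
    omega
  rcases ht : g.tile m j with _ | _ | _ | _ | _ | _ | _ <;> simp_all [hasE, hasW]

/-- The crossing of the pipes `j` and `j + 1` in the final step. -/
lemma IsLabeling.exists_final_cross (hL : IsLabeling g V H) (hg : IsTiling g) (hi : 1 ≤ i)
    (hin : i < g.n) (hj : 1 ≤ j) (hjn : j < g.n) (hbl : g.tile i j = .blank)
    (hthru : ∀ t, i < t → t ≤ g.n → g.tile t (j + 1) = .vert ∨ g.tile t (j + 1) = .cross) :
    ∃ k, i < k ∧ k ≤ g.n ∧ g.tile k (j + 1) = .cross ∧ H k (j + 1) = j := by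
  obtain ⟨k, hk1, hk2, hk3, hk4⟩ : ∃ k, i < k ∧ k ≤ g.n ∧ g.tile k j = .se ∧
      ∀ t, k < t → t ≤ g.n → g.tile t j = .vert ∨ g.tile t j = .cross := by
    by_cases hse : g.tile g.n j = .se
    · exact ⟨g.n, hin, le_rfl, hse, fun t _ _ => by omega⟩
    · have hb := hg.no_bump g.n j ⟨hg.pos, le_rfl, hj, hjn.le⟩
      have hS := hg.bot j hj hjn.le
      have hth : g.tile g.n j = .vert ∨ g.tile g.n j = .cross := by
        rcases ht : g.tile g.n j with _ | _ | _ | _ | _ | _ | _ <;> simp_all [hasS]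
      obtain ⟨k, hk1, hk2, hk3, hk4⟩ := hg.exists_se_above hi hin le_rfl hj hjn.le
        (by rcases hth with h | h <;> simp [h, hasN]) (by simp [hbl, hasS])
      refine ⟨k, hk1, hk2.le, hk3, fun t h1 h2 => ?_⟩
      rcases Nat.eq_or_lt_of_le h2 with rfl | h2
      · exact hth
      · exact hk4 t h1 h2
  have hVk : V k j = j := by
    rw [hL.V_const hk2 le_rfl hj hjn.le hk4, hL.bottom j hj hjn.le]
  have hHk := hL.se k j ⟨by omega, hk2, hj, hjn.le⟩ hk3
  have hmk := hg.match_h k j (by omega) hk2 hj hjn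
  have hck : g.tile k (j + 1) = .cross := by
    rcases hthru k hk1 hk2 with h | h
    · simp [h, hk3, hasE, hasW] at hmk
    · exact h
  refine ⟨k, hk1, hk2, hck, ?_⟩
  rw [hL.east k (j + 1) ⟨by omega, hk2, by omega, by omega⟩ (Or.inr hck)]
  simpa [hHk] using hVk

lemma MemBPD.nablaLoop_spec {w : Perm'} (fuel : ℕ) (hB : MemBPD w g) (hin : InGrid g i j)
    (hbl : g.tile i j = .blank) (hf : g.n < fuel + j) :
    1 ≤ (nablaLoop g fuel (i, j)).2 ∧
    MemBPD (sT (nablaLoop g fuel (i, j)).2 * w) (nablaLoop g fuel (i, j)).1 ∧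
    w.symm ((nablaLoop g fuel (i, j)).2 + 1) < w.symm (nablaLoop g fuel (i, j)).2 := by
  induction fuel generalizing g i j with
  | zero =>
    obtain ⟨h1, h2, h3, h4⟩ := hin
    omega
  | succ fuel ih =>
    have hg := hB.1.isTiling
    obtain ⟨V, H, hL⟩ := exists_isLabeling g
    have hR := hB.1.isReducedLabeling hL
    obtain ⟨hjs, hsn, hsb, hsnb⟩ := hg.slideEast_spec hin hbl
    obtain ⟨hi, hin', hj, -⟩ := hin
    rw [nablaLoop]
    generalize slideEast g i j = s at *
    have hs1 : 1 ≤ s := by omega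
    have hi_lt : i < g.n := by
      rcases Nat.lt_or_ge i g.n with h | h
      · exact h
      · obtain rfl : i = g.n := by omega
        have := hg.bot s hs1 hsn.le
        simp [hsb, hasS] at this
    have hhead := hg.head_of_blank hi hin' hs1 hsn hsb hsnb
    have hinr : InGrid g i (s + 1) := ⟨hi, hin', by omega, by omega⟩
    have hheadS : hasS (g.tile i (s + 1)) = true := by
      rcases hhead with h | h <;> simp [h, hasS]
    rw [hL.pipeFromS_eq hg hinr hheadS]
    dsimp only
    split_ifs with hp
    · have hthru : ∀ t, i < t → t ≤ g.n → g.tile t (s + 1) = .vert ∨ g.tile t (s + 1) = .cross :=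
        fun t h1 h2 => hL.through_of_V_eq hg hinr hheadS hp h1 h2
      have hback : ∀ k, i < k → k ≤ g.n → g.tile k (s + 1) = .cross →
          backAux g (2 * g.n + 2) k (s + 1) false = some (H k (s + 1)) := fun k h1 h2 h3 =>
        (hL.backAux_eq hg _ k (s + 1) ⟨by omega, h2, by omega, by omega⟩ (by omega)).2
          (by simp [h3, hasE])
      obtain ⟨k, hk1, hk2, hk3, hk4⟩ := hL.exists_final_cross hg hi hi_lt hs1 hsn hsb hthru
      obtain ⟨m, hm⟩ := find?_range'_one_isSome (n := g.n) (x := k) (p := fun x =>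
        decide (i < x) && (g.tile x (s + 1) == Tile.cross) &&
        (backAux g (2 * g.n + 2) x (s + 1) false == some s)) (by omega) hk2
        (by simp [hk1, hk3, hback k hk1 hk2 hk3, hk4])
      rw [hm]
      obtain ⟨hm1, -, hmn, -⟩ := find?_range'_one.1 hm
      simp only [Bool.and_eq_true, decide_eq_true_eq, beq_iff_eq] at hm1
      obtain ⟨⟨him, hcr⟩, hbk⟩ := hm1
      rw [hback m him hmn hcr] at hbk
      have hinm : InGrid g m (s + 1) := ⟨by omega, hmn, by omega, by omega⟩
      have hHm : H m s = s := by
        rw [← Option.some.inj hbk]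
        have := hL.east m (s + 1) hinm (Or.inr hcr)
        rw [Option.some.inj hbk] at this ⊢
        exact this.symm
      have hins : InGrid g m s := ⟨by omega, hmn, hs1, hsn.le⟩
      obtain ⟨hse, hVm⟩ := hL.se_of_H_eq hg hins
        (by rw [hg.match_h m s (by omega) hmn hs1 hsn, hcr]; rfl) hHm
      have hS : IsSwappable g i (g.n + 1) s := ⟨hi, by omega, hi_lt, le_rfl, hs1, hsn, hsb, hhead,
        fun x h1 h2 => hthru x h1 (by omega), fun h => by omega⟩
      dsimp only
      rw [hS.nablaIter_eq_final hg him hmn hcr hse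
        fun x h1 h2 => hL.through_of_V_eq hg hins (by simp [hse, hasS]) hVm h1 h2]
      refine ⟨hs1, hS.memBPD hB (Or.inr ⟨rfl, rfl⟩), hB.symm_lt_of_cross hL hs1 hinm hcr ?_ hHm⟩
      rw [← hL.V_const him.le hmn (by omega) (by omega) fun t h1 h2 => hthru t h1 (by omega), hp]
    · obtain ⟨k, hk1, hk2, hk3, hk4, hk5⟩ := hL.exists_nw_of_V_ne hg hinr hheadS hp
      obtain ⟨m, hm⟩ := find?_range'_one_isSome (n := g.n) (x := k) (p := fun x =>
        decide (i < x) && (g.tile x (s + 1) == Tile.nw)) (by omega) hk2 (by simp [hk1, hk3])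
      rw [hm]
      obtain ⟨hm1, hm2, hmn, hmin⟩ := find?_range'_one.1 hm
      simp only [Bool.and_eq_true, decide_eq_true_eq, beq_iff_eq] at hm1
      obtain rfl : m = k := by
        rcases lt_trichotomy m k with h | h | h
        · have := (hk5 m hm1.1 h).1
          simp [hm1.2] at this
        · exact h
        · have := hmin k (by omega) h
          simp [hk1, hk3] at this
      have hS := hL.isSwappable_of_nw hg hR hi hk1 hk2 hs1 hsn hsb hhead hk3 hk4 hk5
      dsimp only
      rw [hS.nablaIter_eq hg hk2]
      have hB' := hS.memBPD hB (Or.inl ⟨hk2, rfl⟩)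
      rw [one_mul] at hB'
      exact ih hB' ⟨by omega, hk2, by omega, by rw [colSwap_n]; omega⟩
        (colSwap_foot_right hk1 hk2) (by rw [colSwap_n]; omega)

/-! ### Grids without blank tiles -/

lemma IsTiling.tile_of_no_blank (hg : IsTiling g) (h : ∀ x y, InGrid g x y → g.tile x y ≠ .blank)
    {x y : ℕ} (hin : InGrid g x y) :
    g.tile x y = if y < x then .vert else if y = x then .se else .horiz := by
  obtain ⟨h1, h2, h3, h4⟩ := id hin
  induction hd : x + y using Nat.strong_induction_on generalizing x y with
  | _ d ih =>
  have hN : hasN (g.tile x y) = decide (y < x) := by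
    rcases Nat.eq_or_lt_of_le h1 with rfl | hx
    · rw [hg.top y h3 h4, eq_comm, decide_eq_false_iff_not]
      omega
    · have hm := hg.match_v (x - 1) y (by omega) (by omega) h3 h4
      rw [Nat.sub_add_cancel h1, ih (x - 1 + y) (by omega) (x := x - 1) (y := y)
        ⟨by omega, by omega, h3, h4⟩ (by omega) (by omega) h3 h4 rfl] at hm
      rw [← hm]
      split_ifs <;> simp [hasS] <;> omega
  have hW : hasW (g.tile x y) = decide (x < y) := by
    rcases Nat.eq_or_lt_of_le h3 with rfl | hy
    · rw [hg.left x h1 h2, eq_comm, decide_eq_false_iff_not]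
      omega
    · have hm := hg.match_h x (y - 1) h1 h2 (by omega) (by omega)
      rw [Nat.sub_add_cancel h3, ih (x + (y - 1)) (by omega) (x := x) (y := y - 1)
        ⟨h1, h2, by omega, by omega⟩ h1 h2 (by omega) (by omega) rfl] at hm
      rw [← hm]
      split_ifs <;> simp [hasE] <;> omega
  have hbl := h x y hin
  have hb := hg.no_bump x y hin
  rcases lt_trichotomy y x with hxy | rfl | hxy
  · rw [if_pos hxy]
    rw [decide_eq_true hxy] at hN
    rw [decide_eq_false (by omega)] at hW
    cases ht : g.tile x y <;> simp_all [hasN, hasW]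
  · rw [if_neg (lt_irrefl _), if_pos rfl]
    simp only [lt_irrefl, decide_false] at hN hW
    cases ht : g.tile y y <;> simp_all [hasN, hasW]
  · rw [if_neg (by omega), if_neg hxy.ne']
    rw [decide_eq_false (by omega)] at hN
    rw [decide_eq_true hxy] at hW
    cases ht : g.tile x y <;> simp_all [hasN, hasW]

lemma plen_one : plen 1 = 0 :=
  Nat.le_zero.1 (Nat.sInf_le ⟨[], ⟨by simp, rfl⟩, rfl⟩)

/-- A bumpless pipe dream of a nontrivial permutation has a blank tile. -/
lemma MemBPD.exists_blank {w : Perm'} (hB : MemBPD w g) (hl : 1 ≤ plen w) :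
    ∃ x y, InGrid g x y ∧ g.tile x y = .blank := by
  by_contra! hno
  have hg := hB.1.isTiling
  obtain ⟨V, H, hL⟩ := exists_isLabeling g
  have hw : w = 1 := by
    ext r
    rw [Equiv.Perm.one_apply]
    by_cases hr : 1 ≤ r ∧ r ≤ g.n
    · obtain ⟨h1, h2⟩ := hr
      rw [← hB.exit_label hL h1 h2]
      have hV : V r r = r := by
        rw [hL.V_const h2 le_rfl h1 h2 fun t ht1 ht2 => Or.inl ?_, hL.bottom r h1 h2]
        rw [hg.tile_of_no_blank hno ⟨by omega, ht2, h1, h2⟩, if_pos ht1]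
      have hH : ∀ y, r ≤ y → y ≤ g.n → H r y = r := by
        intro y hy
        induction y, hy using Nat.le_induction with
        | base =>
          intro _
          rw [hL.se r r ⟨h1, h2, h1, h2⟩, hV]
          rw [hg.tile_of_no_blank hno ⟨h1, h2, h1, h2⟩]
          simp
        | succ y hy ih =>
          intro hyn
          have hin : InGrid g r (y + 1) := ⟨h1, h2, by omega, hyn⟩
          rw [hL.east r (y + 1) hin (Or.inl ?_), Nat.add_sub_cancel, ih (by omega)]
          rw [hg.tile_of_no_blank hno hin, if_neg (by omega), if_neg (by omega)]
      exact hH g.n h2 le_rfl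
    · rcases Nat.eq_zero_or_pos r with rfl | h
      · exact hB.2.1
      · exact hB.2.2.1 r (by omega)
  rw [hw, plen_one] at hl
  omega

lemma getLastD_mem_of_ne_nil {l : List ℕ} (h : l ≠ []) (d : ℕ) : l.getLastD d ∈ l := by
  rw [List.getLastD_eq_getLast?, List.getLast?_eq_getLast_of_ne_nil h]
  exact List.getLast_mem h

lemma MemBPD.nablaPop_spec {w : Perm'} (hB : MemBPD w g) (hl : 1 ≤ plen w) :
    1 ≤ (pop g).2 ∧ MemBPD (sT (pop g).2 * w) (nabla g) ∧
    w.symm ((pop g).2 + 1) < w.symm (pop g).2 := by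
  obtain ⟨x, y, ⟨h1, h2, h3, h4⟩, hbl⟩ := hB.exists_blank hl
  obtain ⟨r, hr⟩ := find?_range'_one_isSome (n := g.n) (x := x)
    (p := fun i => (List.range' 1 g.n).any (fun j => g.tile i j == Tile.blank)) h1 h2
    (List.any_eq_true.2 ⟨y, by rw [List.mem_range'_1]; omega, by simp [hbl]⟩)
  obtain ⟨hr1, hr2, hr3, -⟩ := find?_range'_one.1 hr
  obtain ⟨z, hz1, hz2⟩ := List.any_eq_true.1 hr1
  have hmem := getLastD_mem_of_ne_nil (l := (List.range' 1 g.n).filter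
    (fun j => g.tile r j == Tile.blank)) (List.ne_nil_of_mem (List.mem_filter.2 ⟨hz1, hz2⟩)) 0
  rw [List.mem_filter, List.mem_range'_1, beq_iff_eq] at hmem
  have key := hB.nablaLoop_spec (g.n + 1) ⟨hr2, hr3, hmem.1.1, by omega⟩ hmem.2 (by omega)
  unfold nabla pop nablaPop
  rw [hr]
  exact key

end Loop

/-- For `B ∈ BPD(w)` with `ℓ(w) ≥ 1` and `pop(B) = (r, a)`, the output
`∇B` of the Gao–Huang procedure is a bumpless pipe dream with permutation `s_a w`, and
`ℓ(s_a w) = ℓ(w) − 1`. -/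
theorem stmt19 (w : Perm') (hw : IsPerm w) (hl : 1 ≤ plen w)
    (B : Grid) (hB : MemBPD w B) :
    MemBPD (sT (pop B).2 * w) (nabla B) ∧ plen (sT (pop B).2 * w) + 1 = plen w := by
  obtain ⟨h1, h2, h3⟩ := hB.nablaPop_spec hl
  exact ⟨h2, plen_sT_mul h1 hl h3⟩

end BPDPaper
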